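/- arXiv:1406.0576 — 4 statements merged into one kernel-verified Lean document; each statement's English description precedes it below -/
import Mathlib

section
/- There exists an absolute constant c > 0 such that every combinatorial market in which each consumer's valuation is a weighted rank function of a uniform matroid admits a competitive bundling equilibrium whose revenue is at least c · OPT / (log(μ) + 2), where μ = min{n, m}. -/
open Finset

/-- A combinatorial market with `n` consumers and `m` items. Each consumer has a
normalized (`v i ∅ = 0`) and monotone valuation over subsets of items. -/
structure Market (n m : ℕ) where
  v : Fin n → Finset (Fin m) → ℝ
  v_empty : ∀ i, v i ∅ = 0
  v_mono : ∀ i, ∀ S T : Finset (Fin m), S ⊆ T → v i S ≤ v i T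

/-- An allocation assigns pairwise disjoint sets of items to consumers. -/
def IsAllocation {n m : ℕ} (S : Fin n → Finset (Fin m)) : Prop :=
  ∀ i j : Fin n, i ≠ j → Disjoint (S i) (S j)

/-- The welfare of an allocation. -/
def allocWelfare {n m : ℕ} (Mk : Market n m) (S : Fin n → Finset (Fin m)) : ℝ :=
  ∑ i, Mk.v i (S i)

/-- The optimal welfare over all allocations. -/
noncomputable def OPT {n m : ℕ} (Mk : Market n m) : ℝ :=
  sSup {w : ℝ | ∃ S : Fin n → Finset (Fin m), IsAllocation S ∧ allocWelfare Mk S = w}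

/-- A competitive bundling equilibrium: a partition of the items into nonempty bundles,
nonnegative bundle prices, and an assignment of every bundle to a consumer (market
clearance), such that every consumer's assigned set of bundles maximizes his profit
over all sets of bundles. -/
structure CBE {n m : ℕ} (Mk : Market n m) where
  bundles : Finset (Finset (Fin m))
  price : Finset (Fin m) → ℝ
  assign : Finset (Fin m) → Fin n
  bundles_nonempty : ∀ b ∈ bundles, b.Nonempty
  bundles_disjoint : ∀ b ∈ bundles, ∀ b' ∈ bundles, b ≠ b' → Disjoint b b'
  bundles_cover : bundles.biUnion id = Finset.univ
  price_nonneg : ∀ b ∈ bundles, 0 ≤ price b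
  profit_max : ∀ i : Fin n, ∀ T : Finset (Finset (Fin m)), T ⊆ bundles →
    Mk.v i ((bundles.filter fun b => assign b = i).biUnion id)
        - ∑ b ∈ bundles.filter fun b => assign b = i, price b
      ≥ Mk.v i (T.biUnion id) - ∑ b ∈ T, price b

/-- The welfare of a competitive bundling equilibrium. -/
def CBE.welfare {n m : ℕ} {Mk : Market n m} (E : CBE Mk) : ℝ :=
  ∑ i, Mk.v i ((E.bundles.filter fun b => E.assign b = i).biUnion id)

/-- The revenue of a competitive bundling equilibrium. -/
def CBE.revenue {n m : ℕ} {Mk : Market n m} (E : CBE Mk) : ℝ :=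
  ∑ b ∈ E.bundles, E.price b

/-- A market is multi-unit if valuations depend only on the number of items. -/
def MultiUnit {n m : ℕ} (Mk : Market n m) : Prop :=
  ∀ i, ∀ S T : Finset (Fin m), S.card = T.card → Mk.v i S = Mk.v i T



theorem finite_gap {ι : Type*} [Finite ι] (f : ι → ℝ) : ∃ ε > 0, ∀ i, 0 < f i → ε ≤ f i := by
  classical
  have := Fintype.ofFinite ι
  by_cases h : (univ.filter fun i => 0 < f i).Nonempty
  · obtain ⟨i, hi, hm⟩ := Finset.exists_min_image _ f h
    exact ⟨f i, (by simpa using hi), fun j hj => hm j (by simpa using hj)⟩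
  · refine ⟨1, one_pos, fun i hi => ?_⟩
    exact absurd ⟨i, by simpa using hi⟩ h

theorem assign_dual {X : Type*} [Fintype X] [DecidableEq X] [Nonempty X] (W : X → X → ℝ)
    (hW : ∀ x y, 0 ≤ W x y) : ∃ σ : Equiv.Perm X, ∃ α β : X → ℝ,
      (∀ x y, W x y ≤ α x + β y) ∧ ∀ x, α x + β (σ x) = W x (σ x) := by
  classical
  obtain ⟨K, hK0, hK⟩ : ∃ K : ℝ, 0 ≤ K ∧ ∀ x y, W x y ≤ K := by
    refine ⟨∑ x, ∑ y, W x y, Finset.sum_nonneg fun i _ => Finset.sum_nonneg fun j _ => hW i j, fun x y => ?_⟩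
    exact (Finset.single_le_sum (f := fun y => W x y) (fun i _ => hW x i) (mem_univ y)).trans
      (Finset.single_le_sum (f := fun x => ∑ y, W x y)
        (fun i _ => Finset.sum_nonneg fun j _ => hW i j) (mem_univ x))
  let S : Set ((X → ℝ) × (X → ℝ)) :=
    Set.Icc (0, 0) (fun _ => K, fun _ => K) ∩ {z | ∀ x y, W x y ≤ z.1 x + z.2 y}
  have hScpt : IsCompact S := by
    refine isCompact_Icc.inter_right ?_
    simp only [Set.ofPred_forall]
    refine isClosed_iInter fun x => isClosed_iInter fun y => ?_
    exact isClosed_le continuous_const (by fun_prop)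
  have hSne : S.Nonempty := by
    refine ⟨(fun _ => K, 0), ⟨⟨?_, ?_⟩, ?_⟩⟩
    · exact ⟨fun _ => hK0, fun _ => le_rfl⟩
    · exact ⟨fun _ => le_rfl, fun _ => hK0⟩
    · intro x y; simpa using hK x y
  obtain ⟨⟨α, β⟩, hmem, hmin⟩ := hScpt.exists_isMinOn hSne
    (f := fun z => ∑ x, z.1 x + ∑ y, z.2 y) (by fun_prop)
  have hfeas : ∀ x y, W x y ≤ α x + β y := hmem.2
  have hglob : ∀ a b : X → ℝ, (∀ x y, W x y ≤ a x + b y) →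
      ∑ x, α x + ∑ y, β y ≤ ∑ x, a x + ∑ y, b y := by
    intro a b hab
    obtain ⟨x0, -, hx0⟩ := Finset.exists_min_image univ a univ_nonempty
    have hb : ∀ y, 0 ≤ b y + a x0 := fun y => by linarith [hab x0 y, hW x0 y]
    have ha : ∀ x, 0 ≤ a x - a x0 := fun x => by linarith [hx0 x (mem_univ x)]
    have h1 : (fun x => min (a x - a x0) K, fun y => min (b y + a x0) K) ∈ S := by
      refine ⟨⟨?_, ?_⟩, ?_⟩
      · exact ⟨fun x => le_min (ha x) hK0, fun x => le_min (hb x) hK0⟩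
      · exact ⟨fun x => min_le_right _ _, fun x => min_le_right _ _⟩
      · intro x y
        show W x y ≤ min (a x - a x0) K + min (b y + a x0) K
        have := hab x y
        have := hK x y
        have := ha x
        have := hb y
        rcases min_choice (a x - a x0) K with h | h <;>
        rcases min_choice (b y + a x0) K with h' | h' <;> rw [h, h'] <;> linarith
    have h2 := hmin h1
    simp only [Set.mem_ofPred_eq] at h2
    refine h2.trans ?_
    calc _ ≤ ∑ x, (a x - a x0) + ∑ y, (b y + a x0) :=
          add_le_add (Finset.sum_le_sum fun _ _ => min_le_left _ _)
            (Finset.sum_le_sum fun _ _ => min_le_left _ _)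
      _ = _ := by rw [Finset.sum_sub_distrib, Finset.sum_add_distrib]; ring
  have hall := (Fintype.all_card_le_filter_rel_iff_exists_injective
    (fun x y : X => α x + β y = W x y)).1 ?_
  · obtain ⟨f, hf, hr⟩ := hall
    exact ⟨Equiv.ofBijective f (Finite.injective_iff_bijective.1 hf), α, β, hfeas, hr⟩
  · intro A
    by_contra! hlt
    set N := univ.filter fun y => ∃ x ∈ A, α x + β y = W x y with hN
    obtain ⟨ε, hε, hgap⟩ := finite_gap (fun z : X × X => α z.1 + β z.2 - W z.1 z.2)
    have := hglob (fun x => α x - if x ∈ A then ε else 0) (fun y => β y + if y ∈ N then ε else 0) ?_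
    · rw [Finset.sum_sub_distrib, Finset.sum_add_distrib] at this
      simp only [Finset.sum_ite_mem, Finset.univ_inter, Finset.sum_const, nsmul_eq_mul] at this
      have h3 : (N.card : ℝ) < A.card := by exact_mod_cast hlt
      nlinarith
    · intro x y
      have h0 := hfeas x y
      by_cases hx : x ∈ A
      · by_cases hy : y ∈ N
        · simp only [hx, hy, if_true]; linarith
        · have : 0 < α x + β y - W x y := by
            rcases h0.lt_or_eq with h | h
            · linarith
            · exact absurd (by rw [hN]; simp only [mem_filter, mem_univ, true_and]; exact ⟨x, hx, h.symm⟩) hy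
          have := hgap (x, y) this
          simp only [hx, hy, if_true, if_false] at *; linarith
      · simp only [hx, if_false]; split_ifs <;> linarith

theorem market_dual {n m : ℕ} (hm : 1 ≤ m) (k : Fin n → ℕ) (w : Fin n → Fin m → ℝ)
    (hw : ∀ l j, 0 ≤ w l j) :
    ∃ (A : Fin n → Finset (Fin m)) (p : Fin m → ℝ) (τ : Fin n → ℝ),
      (∀ j, 0 ≤ p j) ∧ (∀ l, 0 ≤ τ l) ∧ (∀ l j, w l j ≤ p j + τ l) ∧
      (∀ l, (A l).card ≤ k l) ∧ (∀ l l', l ≠ l' → Disjoint (A l) (A l')) ∧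
      ∑ j, p j + ∑ l, (k l : ℝ) * τ l ≤ ∑ l, ∑ j ∈ A l, w l j := by
  classical
  let j0 : Fin m := ⟨0, hm⟩
  let X := (Σ l : Fin n, Fin (k l)) ⊕ Fin m
  have : Nonempty X := ⟨Sum.inr j0⟩
  let W : X → X → ℝ := fun x y => match x, y with
    | Sum.inl s, Sum.inr j => w s.1 j
    | _, _ => 0
  have hW : ∀ x y, 0 ≤ W x y := by
    rintro (s | j) (s' | j') <;> simp [W, hw]
  obtain ⟨σ, α, β0, hf0, ht0⟩ := assign_dual W hW
  obtain ⟨y0, -, hy0⟩ := Finset.exists_min_image univ β0 univ_nonempty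
  obtain ⟨α, β, hf, ht, hβ, hz⟩ : ∃ α β : X → ℝ, (∀ x y, W x y ≤ α x + β y) ∧
      (∀ x, α x + β (σ x) = W x (σ x)) ∧ (∀ y, 0 ≤ β y) ∧ β y0 = 0 := by
    refine ⟨fun x => α x + β0 y0, fun y => β0 y - β0 y0, fun x y => ?_, fun x => ?_, fun y => ?_, ?_⟩
    · linarith [hf0 x y]
    · linarith [ht0 x]
    · linarith [hy0 y (mem_univ y)]
    · ring
  have hWr : ∀ j y, W (Sum.inr j) y = 0 := by
    rintro j (s | j') <;> rfl
  have hαr : ∀ j, α (Sum.inr j) = 0 ∧ β (σ (Sum.inr j)) = 0 := by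
    intro j
    have h1 := hf (Sum.inr j) y0
    have h2 := ht (Sum.inr j)
    have h3 := hβ (σ (Sum.inr j))
    have h4 := hWr j y0
    have h5 := hWr j (σ (Sum.inr j))
    have h6 := hβ y0
    constructor <;> linarith
  have hαs : ∀ s, 0 ≤ α (Sum.inl s) := by
    intro s
    by_cases h : ∃ j s', σ (Sum.inr j) = Sum.inl s'
    · obtain ⟨j, s', h⟩ := h
      have h1 := hf (Sum.inl s) (Sum.inl s')
      have h2 := (hαr j).2
      rw [h] at h2
      have h3 : W (Sum.inl s) (Sum.inl s') = 0 := rfl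
      linarith
    · push Not at h
      have h' : ∀ j, ∃ j', σ (Sum.inr j) = Sum.inr j' := by
        intro j
        rcases hh : σ (Sum.inr j) with s' | j'
        · exact absurd hh (h j s')
        · exact ⟨j', rfl⟩
      obtain ⟨j', hj'⟩ := h' j0
      have h1 := hf (Sum.inl s) (Sum.inr j')
      have h2 := (hαr j0).2
      rw [hj'] at h2
      have := hW (Sum.inl s) (Sum.inr j')
      linarith
  let p : Fin m → ℝ := fun j => β (Sum.inr j)
  have hτex : ∀ l, ∃ t : ℝ, 0 ≤ t ∧ (∀ j, w l j ≤ p j + t) ∧ (∀ a, t ≤ α (Sum.inl ⟨l, a⟩)) := by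
    intro l
    by_cases hk : Nonempty (Fin (k l))
    · obtain ⟨a0, -, ha0⟩ := Finset.exists_min_image univ (fun a => α (Sum.inl ⟨l, a⟩))
        (univ_nonempty (α := Fin (k l)))
      refine ⟨α (Sum.inl ⟨l, a0⟩), hαs _, fun j => ?_, fun a => ha0 a (mem_univ a)⟩
      have := hf (Sum.inl ⟨l, a0⟩) (Sum.inr j)
      have h3 : W (Sum.inl ⟨l, a0⟩) (Sum.inr j) = w l j := rfl
      simp only [p]; linarith
    · refine ⟨∑ j, w l j, Finset.sum_nonneg fun j _ => hw l j, fun j => ?_, fun a => absurd ⟨a⟩ hk⟩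
      have := Finset.single_le_sum (f := fun j => w l j) (fun i _ => hw l i) (mem_univ j)
      have := hβ (Sum.inr j)
      simp only [p]; linarith
  choose τ hτ0 hτf hτα using hτex
  let A : Fin n → Finset (Fin m) := fun l => univ.filter fun j => ∃ a, σ.symm (Sum.inr j) = Sum.inl ⟨l, a⟩
  refine ⟨A, p, τ, fun j => hβ _, hτ0, hτf, ?_, ?_, ?_⟩
  · intro l
    have hex : ∀ j ∈ A l, ∃ a, σ.symm (Sum.inr j) = Sum.inl ⟨l, a⟩ := by
      intro j hj; simpa [A] using hj
    have : (A l).card ≤ (univ : Finset (Fin (k l))).card := by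
      choose f hfj using hex
      by_cases hk : ∃ j, j ∈ A l
      · exact Finset.card_le_card_of_injOn (fun j => if h : j ∈ A l then f j h else f _ hk.choose_spec)
          (fun _ _ => by simp) (by
            intro j hj j' hj' h
            have hj := mem_coe.1 hj
            have hj' := mem_coe.1 hj'
            simp only [hj, hj', dif_pos] at h
            have h1 := hfj j hj
            rw [h, ← hfj j' hj'] at h1
            exact Sum.inr.inj (σ.symm.injective h1))
      · have : A l = ∅ := Finset.eq_empty_of_forall_notMem fun j hj => hk ⟨j, hj⟩
        simp [this]
    simpa using this
  · intro l l' hll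
    rw [Finset.disjoint_left]
    intro j hj hj'
    simp only [A, mem_filter, mem_univ, true_and] at hj hj'
    obtain ⟨a, ha⟩ := hj
    obtain ⟨a', ha'⟩ := hj'
    rw [ha] at ha'
    exact hll (congrArg Sigma.fst (Sum.inl.inj ha'))
  · have e1 : ∑ x, W x (σ x) = ∑ y, W (σ.symm y) y := by
      rw [← Equiv.sum_comp σ (fun y => W (σ.symm y) y)]
      simp
    have e2 : ∑ y, W (σ.symm y) y = ∑ j, W (σ.symm (Sum.inr j)) (Sum.inr j) := by
      rw [Fintype.sum_sum_type]
      have : ∀ s, W (σ.symm (Sum.inl s)) (Sum.inl s) = 0 := by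
        intro s
        rcases σ.symm (Sum.inl s) with a | a <;> rfl
      simp [this]
    have e3 : ∑ l, ∑ j ∈ A l, w l j = ∑ j, W (σ.symm (Sum.inr j)) (Sum.inr j) := by
      have : ∀ l, ∑ j ∈ A l, w l j = ∑ j, if j ∈ A l then w l j else 0 := by
        intro l; simp
      rw [Finset.sum_congr rfl fun l _ => this l, Finset.sum_comm]
      refine Finset.sum_congr rfl fun j _ => ?_
      rcases h : σ.symm (Sum.inr j) with ⟨l, a⟩ | j'
      · rw [Finset.sum_eq_single l]
        · have : j ∈ A l := by simp only [A, mem_filter, mem_univ, true_and]; exact ⟨a, h⟩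
          simp only [this, if_true]; rfl
        · intro l' _ hl'
          rw [if_neg]
          simp only [A, mem_filter, mem_univ, true_and, h]
          rintro ⟨a', ha'⟩
          exact hl' (congrArg Sigma.fst (Sum.inl.inj ha')).symm
        · simp
      · have h0 : W (Sum.inr j') (Sum.inr j) = 0 := rfl
        refine Eq.trans (Finset.sum_eq_zero fun l _ => if_neg ?_) h0.symm
        simp only [A, mem_filter, mem_univ, true_and]
        rintro ⟨a, ha⟩
        rw [h] at ha; cases ha
    have e4 : ∑ x, W x (σ x) = ∑ x, α x + ∑ y, β y := by
      rw [← Equiv.sum_comp σ β, ← Finset.sum_add_distrib]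
      exact Finset.sum_congr rfl fun x _ => (ht x).symm
    have e5 : ∑ l, (k l : ℝ) * τ l ≤ ∑ x, α x := by
      rw [Fintype.sum_sum_type, Fintype.sum_sigma]
      simp only [hαr, Finset.sum_const_zero, add_zero]
      refine Finset.sum_le_sum fun l _ => ?_
      calc (k l : ℝ) * τ l = ∑ a : Fin (k l), τ l := by simp
        _ ≤ _ := Finset.sum_le_sum fun a _ => hτα l a
    have e6 : ∑ j, p j ≤ ∑ y, β y := by
      rw [Fintype.sum_sum_type]
      have : 0 ≤ ∑ s, β (Sum.inl s) := Finset.sum_nonneg fun s _ => hβ _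
      simp only [p]; linarith
    rw [e3, ← e2, ← e1, e4]; linarith

theorem harmonic_select {ι : Type*} [DecidableEq ι] (b : ι → ℝ) (K : ℝ) (s : Finset ι)
    (h : ∀ i ∈ s, b i * ((s.filter fun j => b i ≤ b j).card : ℝ) ≤ K) (hb : ∀ i ∈ s, 0 ≤ b i) :
    ∑ i ∈ s, b i ≤ K * ((harmonic s.card : ℚ) : ℝ) := by
  induction hN : s.card generalizing s with
  | zero => rw [Finset.card_eq_zero] at hN; subst hN; simp
  | succ N ih =>
    have hne : s.Nonempty := by rw [← Finset.card_pos]; omega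
    obtain ⟨i, hi, hmin⟩ := Finset.exists_min_image s b hne
    have h1 := ih (s.erase i) (fun l hl => ?_) (fun l hl => hb l (Finset.mem_of_mem_erase hl))
      (by rw [Finset.card_erase_of_mem hi]; omega)
    · have h2 := h i hi
      have h3 : s.filter (fun j => b i ≤ b j) = s := Finset.filter_true_of_mem hmin
      rw [h3, hN] at h2
      rw [← Finset.add_sum_erase s b hi, harmonic_succ]
      have h4 : b i ≤ K * (((N + 1 : ℕ) : ℝ))⁻¹ := by
        rw [← div_eq_mul_inv, le_div_iff₀ (by positivity)]; exact h2
      push_cast at h4 ⊢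
      rw [mul_add]; linarith
    · have hl' := Finset.mem_of_mem_erase hl
      refine le_trans (mul_le_mul_of_nonneg_left ?_ (hb l hl')) (h l hl')
      exact_mod_cast Finset.card_le_card (Finset.filter_subset_filter _ (Finset.erase_subset _ _))

section ML
variable {n m : ℕ}

def UU (g : Fin m → Fin n) (T : Finset (Fin n)) : Finset (Fin m) := univ.filter fun j => g j ∈ T

def HH (g : Fin m → Fin n) : Finset (Fin n) := univ.image g

noncomputable def util (Mk : Market n m) (g : Fin m → Fin n) (q : Fin n → ℝ) (i : Fin n)
    (T : Finset (Fin n)) : ℝ := Mk.v i (UU g T) - ∑ l ∈ T, q l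

def Happy (Mk : Market n m) (g : Fin m → Fin n) (q : Fin n → ℝ) (i : Fin n) : Prop :=
  ∀ T, util Mk g q i T ≤ util Mk g q i {i}

structure Valid (Mk : Market n m) (g : Fin m → Fin n) (q : Fin n → ℝ) : Prop where
  nonneg : ∀ l, 0 ≤ q l
  zero : ∀ l, l ∉ HH g → q l = 0
  happy : ∀ l ∈ HH g, Happy Mk g q l

theorem mem_HH {g : Fin m → Fin n} {l : Fin n} : l ∈ HH g ↔ ∃ j, g j = l := by
  simp [HH]

theorem util_inter (Mk : Market n m) (g : Fin m → Fin n) (q : Fin n → ℝ)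
    (hz : ∀ l, l ∉ HH g → q l = 0) (i : Fin n) (T : Finset (Fin n)) :
    util Mk g q i (T ∩ HH g) = util Mk g q i T := by
  unfold util
  congr 1
  · congr 1
    ext j
    simp [UU, mem_HH]
  · refine Finset.sum_subset Finset.inter_subset_left fun l hl hl' => hz l fun h => hl' ?_
    exact mem_inter.2 ⟨hl, h⟩

theorem util_empty (Mk : Market n m) (g : Fin m → Fin n) (q : Fin n → ℝ) (i : Fin n) :
    util Mk g q i ∅ = 0 := by
  simp [util, UU, Mk.v_empty]

theorem util_self_nonholder (Mk : Market n m) (g : Fin m → Fin n) (q : Fin n → ℝ)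
    (hz : ∀ l, l ∉ HH g → q l = 0) (i : Fin n) (hi : i ∉ HH g) :
    util Mk g q i {i} = 0 := by
  rw [← util_inter Mk g q hz, Finset.singleton_inter_of_notMem hi, util_empty]

def BMax (Mk : Market n m) (g : Fin m → Fin n) (q : Fin n → ℝ) (z : Fin n)
    (T : Finset (Fin n)) : Prop := T ⊆ HH g ∧ ∀ S, util Mk g q z S ≤ util Mk g q z T

def Dl (Mk : Market n m) (g : Fin m → Fin n) (q : Fin n → ℝ) : ℕ → Fin n → Prop
  | 0, z => ∃ T, BMax Mk g q z T ∧ T.card ≠ 1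
  | k + 1, z => ∃ l, BMax Mk g q z {l} ∧ Dl Mk g q k l

open Classical in
noncomputable def unh (Mk : Market n m) (g : Fin m → Fin n) (q : Fin n → ℝ) : ℕ :=
  (univ.filter fun z => ¬ Happy Mk g q z).card

structure Opt (Mk : Market n m) (R : ℝ) (g : Fin m → Fin n) (q : Fin n → ℝ) : Prop where
  valid : Valid Mk g q
  rev : R ≤ ∑ l, q l
  minH : ∀ g' q', Valid Mk g' q' → R ≤ ∑ l, q' l → (HH g).card ≤ (HH g').card
  maxR : ∀ g' q', Valid Mk g' q' → R ≤ ∑ l, q' l → (HH g').card = (HH g).card →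
    ∑ l, q' l ≤ ∑ l, q l
  minU : ∀ g' q', Valid Mk g' q' → (HH g').card = (HH g).card →
    ∑ l, q' l = ∑ l, q l → unh Mk g q ≤ unh Mk g' q'

theorem UU_swap (g : Fin m → Fin n) (a b : Fin n) (T : Finset (Fin n)) :
    UU (Equiv.swap a b ∘ g) T = UU g (T.image (Equiv.swap a b)) := by
  ext j
  simp only [UU, mem_filter, mem_univ, true_and, Function.comp, mem_image]
  constructor
  · intro h; exact ⟨_, h, by simp⟩
  · rintro ⟨l, hl, h⟩; rw [← h]; simpa using hl

theorem util_swap (Mk : Market n m) (g : Fin m → Fin n) (q : Fin n → ℝ) (a b i : Fin n)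
    (T : Finset (Fin n)) :
    util Mk (Equiv.swap a b ∘ g) (q ∘ Equiv.swap a b) i T
      = util Mk g q i (T.image (Equiv.swap a b)) := by
  unfold util
  rw [UU_swap, Finset.sum_image (fun x _ y _ h => (Equiv.swap a b).injective h)]
  rfl

theorem HH_swap (g : Fin m → Fin n) (a b : Fin n) :
    HH (Equiv.swap a b ∘ g) = (HH g).image (Equiv.swap a b) := by
  simp only [HH, Finset.image_image]

theorem image_swap_swap (a b : Fin n) (T : Finset (Fin n)) :
    (T.image (Equiv.swap a b)).image (Equiv.swap a b) = T := by
  rw [Finset.image_image]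
  have : (⇑(Equiv.swap a b) ∘ ⇑(Equiv.swap a b)) = id := by
    funext x; simp
  rw [this, Finset.image_id]

theorem BMax_swap (Mk : Market n m) (g : Fin m → Fin n) (q : Fin n → ℝ) (a b z : Fin n)
    (T : Finset (Fin n)) (h : BMax Mk g q z T) :
    BMax Mk (Equiv.swap a b ∘ g) (q ∘ Equiv.swap a b) z (T.image (Equiv.swap a b)) := by
  refine ⟨?_, fun S => ?_⟩
  · rw [HH_swap]; exact Finset.image_subset_image h.1
  · rw [util_swap, util_swap, image_swap_swap]; exact h.2 _

theorem Dl_swap (Mk : Market n m) (g : Fin m → Fin n) (q : Fin n → ℝ) (y l1 : Fin n)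
    (hy : y ∉ HH g) (k : ℕ) : ∀ z, Dl Mk g q k z →
    ∃ j ≤ k, Dl Mk (Equiv.swap y l1 ∘ g) (q ∘ Equiv.swap y l1) j z ∨
      Dl Mk (Equiv.swap y l1 ∘ g) (q ∘ Equiv.swap y l1) j l1 := by
  induction k with
  | zero =>
    rintro z ⟨T, hT, hc⟩
    refine ⟨0, le_rfl, Or.inl ⟨_, BMax_swap Mk g q y l1 z T hT, ?_⟩⟩
    rwa [Finset.card_image_of_injective _ (Equiv.swap y l1).injective]
  | succ k ih =>
    rintro z ⟨l, hl, hd⟩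
    obtain ⟨j, hj, h⟩ := ih l hd
    by_cases hll : l = l1
    · subst hll
      exact ⟨j, by omega, Or.inr (by tauto)⟩
    · have hly : l ≠ y := by
        rintro rfl
        exact hy (hl.1 (mem_singleton_self _))
      rcases h with h | h
      · refine ⟨j + 1, by omega, Or.inl ⟨l, ?_, h⟩⟩
        have := BMax_swap Mk g q y l1 z _ hl
        rwa [Finset.image_singleton, Equiv.swap_apply_of_ne_of_ne hly hll] at this
      · exact ⟨j, by omega, Or.inr h⟩

theorem Happy_swap (Mk : Market n m) (g : Fin m → Fin n) (q : Fin n → ℝ) (a b z : Fin n) :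
    Happy Mk (Equiv.swap a b ∘ g) (q ∘ Equiv.swap a b) z ↔
      ∀ T, util Mk g q z T ≤ util Mk g q z {Equiv.swap a b z} := by
  unfold Happy
  simp only [util_swap, Finset.image_singleton]
  constructor
  · intro h T
    have := h (T.image (Equiv.swap a b))
    rwa [image_swap_swap] at this
  · intro h T; exact h _

theorem merge_step (Mk : Market n m) (g : Fin m → Fin n) (q : Fin n → ℝ) (hv : Valid Mk g q)
    (y : Fin n) (hy : y ∉ HH g) (T : Finset (Fin n)) (hT : BMax Mk g q y T) (hc : 2 ≤ T.card) :
    ∃ g' q', Valid Mk g' q' ∧ ∑ l, q' l = ∑ l, q l ∧ (HH g').card < (HH g).card := by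
  have hyT : y ∉ T := fun h => hy (hT.1 h)
  let g' : Fin m → Fin n := fun j => if g j ∈ T then y else g j
  let q' : Fin n → ℝ := fun l => if l = y then ∑ l ∈ T, q l else if l ∈ T then 0 else q l
  let φ : Finset (Fin n) → Finset (Fin n) := fun S =>
    (S \ insert y T) ∪ (if y ∈ S then T else ∅)
  have hTpos : T.Nonempty := by rw [← Finset.card_pos]; omega
  have hH : HH g' = insert y (HH g \ T) := by
    ext l
    simp only [mem_HH, mem_insert, mem_sdiff, g']
    constructor
    · rintro ⟨j, hj⟩
      split_ifs at hj with h
      · exact Or.inl hj.symm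
      · subst hj; exact Or.inr ⟨⟨j, rfl⟩, h⟩
    · rintro (h | ⟨⟨j, rfl⟩, h⟩)
      · obtain ⟨t, ht⟩ := hTpos
        obtain ⟨j, hj⟩ := mem_HH.1 (hT.1 ht)
        exact ⟨j, by simp [hj, ht, h]⟩
      · exact ⟨j, by simp [h]⟩
  have hU : ∀ S, UU g' S = UU g (φ S) := by
    intro S
    ext j
    have hjy : g j ≠ y := fun h => hy (mem_HH.2 ⟨j, h⟩)
    simp only [UU, mem_filter, mem_univ, true_and, g', φ, mem_union, mem_sdiff, mem_insert]
    by_cases h : g j ∈ T <;> by_cases h' : y ∈ S <;> simp [h, h', hjy]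
  have hQ : ∀ S, ∑ l ∈ S, q' l = ∑ l ∈ φ S, q l := by
    intro S
    have hd : Disjoint (S \ insert y T) (if y ∈ S then T else ∅) := by
      rw [Finset.disjoint_left]
      intro l hl hl'
      split_ifs at hl' with h
      · simp [hl'] at hl
      · simp at hl'
    rw [Finset.sum_union hd]
    have h1 : ∀ l, q' l = (if l ∈ insert y T then 0 else q l) +
        (if l = y then ∑ l ∈ T, q l else 0) := by
      intro l
      simp only [q', mem_insert]
      by_cases h : l = y <;> by_cases h' : l ∈ T <;> simp [h, h']
    rw [Finset.sum_congr rfl fun l _ => h1 l, Finset.sum_add_distrib]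
    congr 1
    · rw [← Finset.filter_notMem_eq_sdiff, Finset.sum_filter]
      refine Finset.sum_congr rfl fun l _ => ?_
      by_cases h : l ∈ insert y T <;> simp only [h, if_true, if_false, not_true, not_false_eq_true]
    · rw [Finset.sum_ite_eq' S y]
      split_ifs <;> simp
  have hu : ∀ z S, util Mk g' q' z S = util Mk g q z (φ S) := by
    intro z S; unfold util; rw [hU, hQ]
  refine ⟨g', q', ⟨fun l => ?_, fun l hl => ?_, fun l hl => ?_⟩, ?_, ?_⟩
  · simp only [q']
    split_ifs
    · exact Finset.sum_nonneg fun l _ => hv.nonneg l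
    · exact le_rfl
    · exact hv.nonneg l
  · rw [hH] at hl
    simp only [mem_insert, mem_sdiff, not_or, not_and, not_not] at hl
    simp only [q', hl.1, if_false]
    split_ifs with h
    · rfl
    · exact hv.zero l fun h' => h (hl.2 h')
  · intro S
    rw [hu, hu]
    by_cases hly : l = y
    · subst hly
      have : φ {l} = T := by
        simp only [φ, mem_singleton, if_true]
        rw [Finset.sdiff_eq_empty_iff_subset.2 (by simp), Finset.empty_union]
      rw [this]; exact hT.2 _
    · rw [hH] at hl
      simp only [mem_insert, hly, false_or, mem_sdiff] at hl
      have : φ {l} = {l} := by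
        have h1 : y ∉ ({l} : Finset (Fin n)) := by simpa using fun h => hly h.symm
        simp only [φ, h1, if_false, Finset.union_empty]
        rw [Finset.sdiff_eq_self_iff_disjoint, Finset.disjoint_singleton_left]
        simp [hly, hl.2]
      rw [this]; exact hv.happy l hl.1 _
  · rw [hQ]
    refine Finset.sum_subset (Finset.subset_univ _) fun l _ hl => ?_
    have : l = y := by
      by_contra h
      apply hl
      simp only [φ, mem_union, mem_sdiff, mem_univ, true_and, mem_insert, h, false_or, if_true]
      tauto
    rw [this]; exact hv.zero y hy
  · rw [hH, Finset.card_insert_of_notMem (by simp [hy]), Finset.card_sdiff_of_subset hT.1]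
    have := Finset.card_le_card hT.1
    omega

theorem not_Dl (Mk : Market n m) (R : ℝ) (k : ℕ) : ∀ g q, Opt Mk R g q → ∀ y, y ∉ HH g →
    ¬ Happy Mk g q y → ¬ Dl Mk g q k y := by
  induction k using Nat.strong_induction_on with
  | _ k ih =>
  intro g q ho y hy hun hD
  cases k with
  | zero =>
    obtain ⟨T, hT, hc⟩ := hD
    by_cases h0 : T.card = 0
    · rw [Finset.card_eq_zero] at h0
      subst h0
      apply hun
      intro S
      rw [util_self_nonholder Mk g q ho.valid.zero y hy, ← util_empty Mk g q y]
      exact hT.2 S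
    · obtain ⟨g', q', h1, h2, h3⟩ := merge_step Mk g q ho.valid y hy T hT (by omega)
      have := ho.minH g' q' h1 (by rw [h2]; exact ho.rev)
      omega
  | succ k =>
    obtain ⟨l1, hl1, hd⟩ := hD
    have hl1H : l1 ∈ HH g := hl1.1 (mem_singleton_self _)
    have hne : l1 ≠ y := fun h => hy (h ▸ hl1H)
    have hrev : ∑ l, (q ∘ Equiv.swap y l1) l = ∑ l, q l := Equiv.sum_comp (Equiv.swap y l1) q
    have hcard : (HH (Equiv.swap y l1 ∘ g)).card = (HH g).card := by
      rw [HH_swap, Finset.card_image_of_injective _ (Equiv.swap y l1).injective]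
    have hmem : ∀ l, l ∈ HH (Equiv.swap y l1 ∘ g) ↔ Equiv.swap y l1 l ∈ HH g := by
      intro l
      rw [HH_swap, mem_image]
      constructor
      · rintro ⟨a, ha, rfl⟩; simpa using ha
      · intro h; exact ⟨_, h, by simp⟩
    have hhappy : ∀ l, l ≠ l1 → Happy Mk g q l ∨ l = y →
        Happy Mk (Equiv.swap y l1 ∘ g) (q ∘ Equiv.swap y l1) l := by
      intro l hl h
      rw [Happy_swap]
      by_cases hly : l = y
      · subst hly
        rw [Equiv.swap_apply_left]
        exact hl1.2
      · rw [Equiv.swap_apply_of_ne_of_ne hly hl]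
        exact h.resolve_right hly
    have hl1' : l1 ∉ HH (Equiv.swap y l1 ∘ g) := by
      rw [hmem, Equiv.swap_apply_right]; exact hy
    have hval : Valid Mk (Equiv.swap y l1 ∘ g) (q ∘ Equiv.swap y l1) := by
      refine ⟨fun l => ho.valid.nonneg _, fun l hl => ?_, fun l hl => ?_⟩
      · rw [hmem] at hl; exact ho.valid.zero _ hl
      · have hll : l ≠ l1 := fun h => hl1' (h ▸ hl)
        refine hhappy l hll ?_
        by_cases hly : l = y
        · exact Or.inr hly
        · rw [hmem, Equiv.swap_apply_of_ne_of_ne hly hll] at hl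
          exact Or.inl (ho.valid.happy l hl)
    by_cases hh : Happy Mk (Equiv.swap y l1 ∘ g) (q ∘ Equiv.swap y l1) l1
    · have h1 := ho.minU _ _ hval hcard hrev
      refine absurd h1 (not_le.2 ?_)
      unfold unh
      apply Finset.card_lt_card
      rw [Finset.ssubset_iff_of_subset]
      · exact ⟨y, by simpa using hun, by simpa using hhappy y hne.symm (Or.inr rfl)⟩
      · intro l hl
        simp only [mem_filter, mem_univ, true_and] at hl ⊢
        intro h
        by_cases hll : l = l1
        · subst hll; exact hl hh
        · exact hl (hhappy l hll (Or.inl h))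
    · have ho' : Opt Mk R (Equiv.swap y l1 ∘ g) (q ∘ Equiv.swap y l1) := by
        have hU : unh Mk (Equiv.swap y l1 ∘ g) (q ∘ Equiv.swap y l1) ≤ unh Mk g q := by
          unfold unh
          refine Finset.card_le_card_of_injOn (Equiv.swap y l1) ?_
            (fun a _ b _ h => (Equiv.swap y l1).injective h)
          intro l hl
          simp only [coe_filter, mem_univ, true_and, Set.mem_ofPred_eq] at hl ⊢
          by_cases hll : l = l1
          · subst hll; rw [Equiv.swap_apply_right]; exact hun
          · have hly : l ≠ y := by
              rintro rfl; exact hl (hhappy _ hll (Or.inr rfl))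
            rw [Equiv.swap_apply_of_ne_of_ne hly hll]
            exact fun h => hl (hhappy l hll (Or.inl h))
        refine ⟨hval, by rw [hrev]; exact ho.rev, ?_, ?_, ?_⟩
        · rw [hcard]; exact ho.minH
        · rw [hcard, hrev]; exact ho.maxR
        · rw [hcard, hrev]
          exact fun g' q' h1 h2 h3 => hU.trans (ho.minU g' q' h1 h2 h3)
      obtain ⟨j, hj, h⟩ := Dl_swap Mk g q y l1 hy k l1 hd
      exact ih j (by omega) _ _ ho' l1 hl1' hh (by tauto)

theorem opt_happy (Mk : Market n m) (R : ℝ) (g q) (ho : Opt Mk R g q) : ∀ y, Happy Mk g q y := by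
  classical
  intro y
  by_contra hun
  have hy : y ∉ HH g := fun h => hun (ho.valid.happy y h)
  have hyD : ∀ k, ¬ Dl Mk g q k y := fun k => not_Dl Mk R k g q ho y hy hun
  let P : Fin n → Prop := fun z => ∀ k, ¬ Dl Mk g q k z
  have hPy : P y := hyD
  have key : ∀ z T, P z → (∀ S, util Mk g q z S ≤ util Mk g q z T) →
      ∃ l ∈ T, l ∈ HH g ∧ P l := by
    intro z T hz hT
    have hm : BMax Mk g q z (T ∩ HH g) :=
      ⟨Finset.inter_subset_right, fun S => by rw [util_inter Mk g q ho.valid.zero]; exact hT S⟩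
    have hc : (T ∩ HH g).card = 1 := by
      by_contra h
      exact hz 0 ⟨_, hm, h⟩
    obtain ⟨l, hl⟩ := Finset.card_eq_one.1 hc
    have hl' : l ∈ T ∩ HH g := by rw [hl]; exact mem_singleton_self l
    refine ⟨l, (mem_inter.1 hl').1, (mem_inter.1 hl').2, fun k hk => hz (k + 1) ⟨l, ?_, hk⟩⟩
    rw [← hl]; exact hm
  obtain ⟨ε, hε, hgap⟩ := finite_gap
    (fun x : Fin n × Finset (Fin n) × Finset (Fin n) =>
      util Mk g q x.1 x.2.1 - util Mk g q x.1 x.2.2)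
  let d : Fin n → ℝ := fun l => if l ∈ HH g ∧ P l then ε else 0
  have hd0 : ∀ l, 0 ≤ d l := fun l => by simp only [d]; split_ifs <;> linarith
  let q' : Fin n → ℝ := fun l => q l + d l
  have hu : ∀ z T, util Mk g q' z T = util Mk g q z T - ∑ l ∈ T, d l := by
    intro z T
    simp only [util, q', Finset.sum_add_distrib]; ring
  have hval : Valid Mk g q' := by
    refine ⟨fun l => add_nonneg (ho.valid.nonneg l) (hd0 l), fun l hl => ?_, fun z hz T => ?_⟩
    · simp [q', d, hl, ho.valid.zero l hl]
    · rw [hu, hu, Finset.sum_singleton]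
      have h1 := ho.valid.happy z hz T
      have h2 : 0 ≤ ∑ l ∈ T, d l := Finset.sum_nonneg fun l _ => hd0 l
      by_cases hPz : P z
      · have hdz : d z = ε := by simp only [d]; rw [if_pos ⟨hz, hPz⟩]
        rw [hdz]
        by_cases hlt : util Mk g q z T < util Mk g q z {z}
        · have := hgap (z, {z}, T) (by simpa using hlt)
          simp only at this
          linarith
        · obtain ⟨l, hlT, hlH, hPl⟩ := key z T hPz
            (fun S => (ho.valid.happy z hz S).trans (not_lt.1 hlt))
          have h3 : d l ≤ ∑ l ∈ T, d l := Finset.single_le_sum (fun i _ => hd0 i) hlT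
          have hdl : d l = ε := by simp only [d]; rw [if_pos ⟨hlH, hPl⟩]
          linarith
      · have hdz : d z = 0 := by simp only [d]; rw [if_neg fun h => hPz h.2]
        linarith
  have hsum : ∑ l, q' l = ∑ l, q l + ∑ l, d l := by simp only [q', Finset.sum_add_distrib]
  have hdpos : 0 < ∑ l, d l := by
    obtain ⟨T, -, hT⟩ := Finset.exists_max_image (univ : Finset (Finset (Fin n)))
      (util Mk g q y) univ_nonempty
    obtain ⟨l, -, hlH, hPl⟩ := key y T hPy (fun S => hT S (mem_univ S))
    have h3 : d l ≤ ∑ l, d l := Finset.single_le_sum (fun i _ => hd0 i) (mem_univ l)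
    have hdl : d l = ε := by simp only [d]; rw [if_pos ⟨hlH, hPl⟩]
    linarith
  have := ho.maxR g q' hval (by have := ho.rev; linarith) rfl
  linarith

theorem valid_compact (Mk : Market n m) (g : Fin m → Fin n) :
    IsCompact {q : Fin n → ℝ | Valid Mk g q} := by
  have hsub : {q : Fin n → ℝ | Valid Mk g q} ⊆ Set.Icc 0 (fun l => Mk.v l univ) := by
    intro q hq
    refine ⟨fun l => hq.nonneg l, fun l => ?_⟩
    by_cases hl : l ∈ HH g
    · have h1 := hq.happy l hl ∅
      rw [util_empty] at h1
      simp only [util, Finset.sum_singleton] at h1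
      have := Mk.v_mono l _ univ (Finset.subset_univ (UU g {l}))
      show q l ≤ Mk.v l univ
      linarith
    · show q l ≤ Mk.v l univ
      rw [hq.zero l hl, ← Mk.v_empty l]
      exact Mk.v_mono l _ _ (Finset.subset_univ _)
  refine isCompact_Icc.of_isClosed_subset ?_ hsub
  have : {q : Fin n → ℝ | Valid Mk g q} = {q | ∀ l, 0 ≤ q l} ∩ {q | ∀ l, l ∉ HH g → q l = 0} ∩
      {q | ∀ l, l ∈ HH g → ∀ T, util Mk g q l T ≤ util Mk g q l {l}} := by
    ext q
    exact ⟨fun h => ⟨⟨h.nonneg, h.zero⟩, h.happy⟩, fun h => ⟨h.1.1, h.1.2, h.2⟩⟩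
  rw [this]
  simp only [Set.ofPred_forall]
  refine IsClosed.inter (IsClosed.inter ?_ ?_) ?_
  · exact isClosed_iInter fun l => isClosed_le continuous_const (by fun_prop)
  · exact isClosed_iInter fun l => isClosed_iInter fun _ => isClosed_eq (by fun_prop) continuous_const
  · refine isClosed_iInter fun l => isClosed_iInter fun _ => isClosed_iInter fun T => ?_
    unfold util
    exact isClosed_le (by fun_prop) (by fun_prop)

theorem exists_opt (Mk : Market n m) (R : ℝ) (g0 : Fin m → Fin n) (q0 : Fin n → ℝ)
    (hv : Valid Mk g0 q0) (hR : R ≤ ∑ l, q0 l) : ∃ g q, Opt Mk R g q := by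
  classical
  have hex : ∃ h : ℕ, ∃ g q, Valid Mk g q ∧ R ≤ ∑ l, q l ∧ (HH g).card = h :=
    ⟨_, g0, q0, hv, hR, rfl⟩
  obtain ⟨g1, q1, hv1, hR1, hc1⟩ := Nat.find_spec hex
  have hmin := fun k hk => Nat.find_min hex (m := k) hk
  generalize Nat.find hex = h0 at *
  have hminH : ∀ g' q', Valid Mk g' q' → R ≤ ∑ l, q' l → h0 ≤ (HH g').card := by
    intro g' q' h1 h2
    by_contra hlt
    exact hmin _ (not_le.1 hlt) ⟨g', q', h1, h2, rfl⟩
  let S : Set ((Fin m → Fin n) × (Fin n → ℝ)) :=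
    ⋃ g : {g : Fin m → Fin n // (HH g).card = h0}, (Prod.mk g.1) '' {q | Valid Mk g.1 q}
  have hS : IsCompact S := isCompact_iUnion fun g =>
    (valid_compact Mk g.1).image (by fun_prop)
  have hSmem : ∀ g q, (g, q) ∈ S ↔ (HH g).card = h0 ∧ Valid Mk g q := by
    intro g q
    simp [S, and_comm]
  obtain ⟨⟨g2, q2⟩, h2, hmax⟩ := hS.exists_isMaxOn ⟨(g1, q1), (hSmem _ _).2 ⟨hc1, hv1⟩⟩
    (f := fun x => ∑ l, x.2 l) (by fun_prop)
  have hmax' : ∀ g q, (HH g).card = h0 → Valid Mk g q → ∑ l, q l ≤ ∑ l, q2 l := by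
    intro g q h1 h2
    exact hmax ((hSmem g q).2 ⟨h1, h2⟩)
  rw [hSmem] at h2
  have hex2 : ∃ u : ℕ, ∃ g q, Valid Mk g q ∧ (HH g).card = h0 ∧ ∑ l, q l = ∑ l, q2 l ∧
    unh Mk g q = u := ⟨_, g2, q2, h2.2, h2.1, rfl, rfl⟩
  obtain ⟨g, q, hv3, hc3, hR3, hu3⟩ := Nat.find_spec hex2
  have hmin2 := fun k hk => Nat.find_min hex2 (m := k) hk
  generalize Nat.find hex2 = u0 at *
  have hR2 := hmax' g1 q1 hc1 hv1
  refine ⟨g, q, hv3, by linarith, ?_, ?_, ?_⟩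
  · rw [hc3]; exact hminH
  · rw [hc3, hR3]; exact fun g' q' a b c => hmax' g' q' c a
  · rw [hc3, hR3, hu3]
    intro g' q' a b c
    by_contra hlt
    exact hmin2 _ (not_le.1 hlt) ⟨g', q', a, b, c, rfl⟩

end ML

section ST
variable {n m : ℕ}

theorem cbe_of_happy (hm : 1 ≤ m) (Mk : Market n m) (g : Fin m → Fin n) (q : Fin n → ℝ)
    (hv : Valid Mk g q) (hh : ∀ y, Happy Mk g q y) : ∃ E : CBE Mk, E.revenue = ∑ l, q l := by
  classical
  let B : Fin n → Finset (Fin m) := fun l => UU g {l}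
  let asg : Finset (Fin m) → Fin n := fun b => if h : b.Nonempty then g (b.min' h) else g ⟨0, hm⟩
  have hBmem : ∀ l j, j ∈ B l ↔ g j = l := by intro l j; simp [B, UU]
  have hBne : ∀ l ∈ HH g, (B l).Nonempty := by
    intro l hl
    obtain ⟨j, hj⟩ := mem_HH.1 hl
    exact ⟨j, (hBmem l j).2 hj⟩
  have hasg : ∀ l ∈ HH g, asg (B l) = l := by
    intro l hl
    simp only [asg]
    rw [dif_pos (hBne l hl)]
    exact (hBmem l _).1 (Finset.min'_mem _ _)
  have hinj : ∀ T ⊆ HH g, Set.InjOn B (T : Set (Fin n)) := by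
    intro T hT a ha b hb h
    rw [← hasg a (hT ha), ← hasg b (hT hb), h]
  have hbi : ∀ T, (T.image B).biUnion id = UU g T := by
    intro T
    ext j
    simp only [mem_biUnion, mem_image, id]
    constructor
    · rintro ⟨b, ⟨l, hl, rfl⟩, hj⟩
      rw [hBmem] at hj
      simp [UU, hj, hl]
    · intro hj
      exact ⟨B (g j), ⟨g j, by simpa [UU] using hj, rfl⟩, (hBmem _ _).2 rfl⟩
  have hsum : ∀ T ⊆ HH g, ∑ b ∈ T.image B, q (asg b) = ∑ l ∈ T, q l := by
    intro T hT
    rw [Finset.sum_image (hinj T hT)]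
    exact Finset.sum_congr rfl fun l hl => by rw [hasg l (hT hl)]
  have hfil : ∀ i, ((HH g).image B).filter (fun b => asg b = i) = ({i} ∩ HH g).image B := by
    intro i
    ext b
    simp only [mem_filter, mem_image, mem_inter, mem_singleton]
    constructor
    · rintro ⟨⟨l, hl, rfl⟩, h⟩
      rw [hasg l hl] at h
      exact ⟨l, ⟨h, hl⟩, rfl⟩
    · rintro ⟨l, ⟨rfl, hl⟩, rfl⟩
      exact ⟨⟨l, hl, rfl⟩, hasg l hl⟩
  refine ⟨⟨(HH g).image B, fun b => q (asg b), asg, ?_, ?_, ?_, ?_, ?_⟩, ?_⟩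
  · intro b hb
    obtain ⟨l, hl, rfl⟩ := mem_image.1 hb
    exact hBne l hl
  · intro b hb b' hb' hne
    obtain ⟨l, hl, rfl⟩ := mem_image.1 hb
    obtain ⟨l', hl', rfl⟩ := mem_image.1 hb'
    rw [Finset.disjoint_left]
    intro j hj hj'
    rw [hBmem] at hj hj'
    exact hne (by rw [← hj, ← hj'])
  · rw [hbi]
    ext j
    simp [UU, mem_HH]
  · intro b _; exact hv.nonneg _
  · intro i T hT
    obtain ⟨T0, hT0, rfl⟩ := Finset.subset_image_iff.1 hT
    have hT0 : T0 ⊆ HH g := by exact_mod_cast hT0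
    rw [hfil, hbi, hbi, hsum T0 hT0, hsum _ Finset.inter_subset_right]
    have h1 := hh i T0
    rw [← util_inter Mk g q hv.zero i {i}] at h1
    exact h1
  · show ∑ b ∈ (HH g).image B, q (asg b) = _
    rw [hsum _ subset_rfl]
    exact Finset.sum_subset (Finset.subset_univ _) fun l _ hl => hv.zero l hl

theorem cbe_of_valid (hm : 1 ≤ m) (Mk : Market n m) (g : Fin m → Fin n) (q : Fin n → ℝ)
    (hv : Valid Mk g q) : ∃ E : CBE Mk, ∑ l, q l ≤ E.revenue := by
  obtain ⟨g', q', ho⟩ := exists_opt Mk _ g q hv le_rfl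
  obtain ⟨E, hE⟩ := cbe_of_happy hm Mk g' q' ho.valid (opt_happy Mk _ g' q' ho)
  exact ⟨E, by rw [hE]; exact ho.rev⟩

theorem start (hm : 1 ≤ m) (Mk : Market n m) (C : Finset (Fin n)) (hC : C.Nonempty)
    (A : Fin n → Finset (Fin m)) (hne : ∀ l ∈ C, (A l).Nonempty)
    (hdis : ∀ l ∈ C, ∀ l' ∈ C, l ≠ l' → Disjoint (A l) (A l'))
    (p : Fin m → ℝ) (hp : ∀ j, 0 ≤ p j) (hp0 : ∀ j, (∀ l ∈ C, j ∉ A l) → p j = 0)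
    (Q : ℝ) (hQ : 0 ≤ Q) (β : Fin n → ℝ) (hβ : ∀ l ∈ C, Q ≤ β l)
    (hA : ∀ l ∈ C, β l ≤ Mk.v l (A l) - ∑ j ∈ A l, p j)
    (hall : ∀ l ∈ C, ∀ S, Mk.v l S - ∑ j ∈ S, p j ≤ β l) :
    ∃ E : CBE Mk, (C.card : ℝ) * Q + ∑ j, p j ≤ E.revenue := by
  classical
  obtain ⟨i0, hi0⟩ := hC
  let g : Fin m → Fin n := fun j => if h : ∃ l, l ∈ C ∧ j ∈ A l then h.choose else i0
  have hgC : ∀ j, g j ∈ C := by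
    intro j
    simp only [g]
    split_ifs with h
    · exact h.choose_spec.1
    · exact hi0
  have hgA : ∀ l ∈ C, ∀ j ∈ A l, g j = l := by
    intro l hl j hj
    have h : ∃ l, l ∈ C ∧ j ∈ A l := ⟨l, hl, hj⟩
    simp only [g]
    rw [dif_pos h]
    by_contra hne'
    exact Finset.disjoint_left.1 (hdis _ h.choose_spec.1 l hl hne') h.choose_spec.2 hj
  have hH : HH g = C := by
    ext l
    rw [mem_HH]
    constructor
    · rintro ⟨j, rfl⟩; exact hgC j
    · intro hl
      obtain ⟨j, hj⟩ := hne l hl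
      exact ⟨j, hgA l hl j hj⟩
  let q : Fin n → ℝ := fun l => if l ∈ C then Q + ∑ j ∈ UU g {l}, p j else 0
  have hfib : ∀ T, ∑ l ∈ T, ∑ j ∈ UU g {l}, p j = ∑ j ∈ UU g T, p j := by
    intro T
    rw [← Finset.sum_fiberwise_of_maps_to (s := UU g T) (t := T) (g := g)
      (fun j hj => by simpa [UU] using hj)]
    refine Finset.sum_congr rfl fun l hl => Finset.sum_congr ?_ fun _ _ => rfl
    ext j
    simp only [UU, mem_filter, mem_univ, true_and, mem_singleton]
    constructor
    · rintro rfl; exact ⟨hl, rfl⟩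
    · exact fun h => h.2
  have hqsum : ∀ T ⊆ C, ∑ l ∈ T, q l = (T.card : ℝ) * Q + ∑ j ∈ UU g T, p j := by
    intro T hT
    rw [← hfib, ← nsmul_eq_mul, ← Finset.sum_const, ← Finset.sum_add_distrib]
    exact Finset.sum_congr rfl fun l hl => by simp only [q]; rw [if_pos (hT hl)]
  have hq0 : ∀ l, l ∉ HH g → q l = 0 := by
    intro l hl
    rw [hH] at hl
    simp only [q]; rw [if_neg hl]
  have hval : Valid Mk g q := by
    refine ⟨fun l => ?_, hq0, fun l hl T => ?_⟩
    · simp only [q]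
      split_ifs
      · exact add_nonneg hQ (Finset.sum_nonneg fun j _ => hp j)
      · exact le_rfl
    · rw [hH] at hl
      have h1 : β l - Q ≤ util Mk g q l {l} := by
        unfold util
        rw [hqsum _ (by simpa using hl)]
        have hsub : A l ⊆ UU g {l} := by
          intro j hj
          simp [UU, hgA l hl j hj]
        have e1 : ∑ j ∈ A l, p j = ∑ j ∈ UU g {l}, p j := by
          refine Finset.sum_subset hsub fun j hj hj' => hp0 j fun l' hl' hjl' => ?_
          have e2 := hgA l' hl' j hjl'
          simp only [UU, mem_filter, mem_univ, true_and, mem_singleton] at hj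
          rw [← e2, hj] at hjl'
          exact hj' hjl'
        have := Mk.v_mono l _ _ hsub
        have := hA l hl
        simp only [Finset.card_singleton, Nat.cast_one]
        linarith
      have h2 : util Mk g q l T ≤ β l - Q := by
        rw [← util_inter Mk g q hq0, hH]
        by_cases hT : T ∩ C = ∅
        · rw [hT, util_empty]; linarith [hβ l hl]
        · unfold util
          rw [hqsum _ Finset.inter_subset_right]
          have h3 := hall l hl (UU g (T ∩ C))
          have h4 : (1 : ℝ) ≤ ((T ∩ C).card : ℝ) := by
            exact_mod_cast Finset.card_pos.2 (Finset.nonempty_iff_ne_empty.2 hT)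
          nlinarith
      linarith
  obtain ⟨E, hE⟩ := cbe_of_valid hm Mk g q hval
  refine ⟨E, le_trans (le_of_eq ?_) hE⟩
  have e1 : ∑ l, q l = ∑ l ∈ C, q l :=
    (Finset.sum_subset (Finset.subset_univ _) fun l _ hl => hq0 l (by rwa [hH])).symm
  have e2 : UU g C = univ := by ext j; simp [UU, hgC]
  rw [e1, hqsum C subset_rfl, e2]

end ST

section FIN
variable {n m : ℕ}

theorem w_sum_le (k : ℕ) (w p : Fin m → ℝ) (t : ℝ) (ht : 0 ≤ t) (hf : ∀ j, w j ≤ p j + t)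
    (S : Finset (Fin m)) (hS : S.card ≤ k) : ∑ j ∈ S, w j ≤ ∑ j ∈ S, p j + (k : ℝ) * t := by
  calc ∑ j ∈ S, w j ≤ ∑ j ∈ S, (p j + t) := Finset.sum_le_sum fun j _ => hf j
    _ = ∑ j ∈ S, p j + (S.card : ℝ) * t := by rw [Finset.sum_add_distrib]; simp
    _ ≤ _ := by
      have : (S.card : ℝ) * t ≤ (k : ℝ) * t :=
        mul_le_mul_of_nonneg_right (by exact_mod_cast hS) ht
      linarith

theorem sum_disj_le (A : Fin n → Finset (Fin m)) (hd : ∀ l l', l ≠ l' → Disjoint (A l) (A l'))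
    (p : Fin m → ℝ) : ∑ l, ∑ j ∈ A l, p j = ∑ j ∈ univ.biUnion A, p j := by
  rw [Finset.sum_biUnion]
  intro a _ b _ h
  exact hd a b h

theorem weak_dual (k : Fin n → ℕ) (w : Fin n → Fin m → ℝ) (A : Fin n → Finset (Fin m))
    (p : Fin m → ℝ) (τ : Fin n → ℝ) (hp : ∀ j, 0 ≤ p j) (hτ : ∀ l, 0 ≤ τ l)
    (hf : ∀ l j, w l j ≤ p j + τ l) (hc : ∀ l, (A l).card ≤ k l)
    (hd : ∀ l l', l ≠ l' → Disjoint (A l) (A l')) :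
    ∑ l, ∑ j ∈ A l, w l j ≤ ∑ j, p j + ∑ l, (k l : ℝ) * τ l := by
  have h1 : ∑ l, ∑ j ∈ A l, w l j ≤ ∑ l, (∑ j ∈ A l, p j + (k l : ℝ) * τ l) :=
    Finset.sum_le_sum fun l _ => w_sum_le (k l) (w l) p (τ l) (hτ l) (hf l) _ (hc l)
  rw [Finset.sum_add_distrib, sum_disj_le A hd] at h1
  have h2 : ∑ j ∈ univ.biUnion A, p j ≤ ∑ j, p j :=
    Finset.sum_le_sum_of_subset_of_nonneg (Finset.subset_univ _) fun j _ _ => hp j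
  linarith

theorem dual_slack (k : Fin n → ℕ) (w : Fin n → Fin m → ℝ) (A : Fin n → Finset (Fin m))
    (p : Fin m → ℝ) (τ : Fin n → ℝ) (hp : ∀ j, 0 ≤ p j) (hτ : ∀ l, 0 ≤ τ l)
    (hf : ∀ l j, w l j ≤ p j + τ l) (hc : ∀ l, (A l).card ≤ k l)
    (hd : ∀ l l', l ≠ l' → Disjoint (A l) (A l'))
    (ht : ∑ j, p j + ∑ l, (k l : ℝ) * τ l ≤ ∑ l, ∑ j ∈ A l, w l j) :
    (∀ l, (k l : ℝ) * τ l = ∑ j ∈ A l, w l j - ∑ j ∈ A l, p j) ∧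
    (∀ j, (∀ l, j ∉ A l) → p j = 0) := by
  have hl : ∀ l, ∑ j ∈ A l, w l j ≤ ∑ j ∈ A l, p j + (k l : ℝ) * τ l := fun l =>
    w_sum_le (k l) (w l) p (τ l) (hτ l) (hf l) _ (hc l)
  have h1 : ∑ l, (∑ j ∈ A l, p j + (k l : ℝ) * τ l)
      = ∑ j ∈ univ.biUnion A, p j + ∑ l, (k l : ℝ) * τ l := by
    rw [Finset.sum_add_distrib, sum_disj_le A hd]
  have h2 : ∑ j ∈ univ.biUnion A, p j + ∑ j ∈ univ \ univ.biUnion A, p j = ∑ j, p j := by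
    rw [add_comm]; exact Finset.sum_sdiff (Finset.subset_univ _)
  have h3 : 0 ≤ ∑ j ∈ univ \ univ.biUnion A, p j := Finset.sum_nonneg fun j _ => hp j
  have h4 := Finset.sum_le_sum (s := univ) fun l _ => hl l
  constructor
  · have h5 : ∑ l, ∑ j ∈ A l, w l j = ∑ l, (∑ j ∈ A l, p j + (k l : ℝ) * τ l) :=
      le_antisymm h4 (by linarith)
    have h6 := (Finset.sum_eq_sum_iff_of_le fun l _ => hl l).1 h5
    intro l
    linarith [h6 l (mem_univ l)]
  · have h5 : ∑ j ∈ univ \ univ.biUnion A, p j = 0 := le_antisymm (by linarith) h3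
    intro j hj
    refine (Finset.sum_eq_zero_iff_of_nonneg fun j _ => hp j).1 h5 j ?_
    simp [hj]

def IsRank (Mk : Market n m) (k : Fin n → ℕ) (w : Fin n → Fin m → ℝ) : Prop :=
  ∀ i S, IsGreatest {x : ℝ | ∃ U ⊆ S, U.card ≤ k i ∧ x = ∑ j ∈ U, w i j} (Mk.v i S)

theorem v_le (Mk : Market n m) (k : Fin n → ℕ) (w : Fin n → Fin m → ℝ) (hr : IsRank Mk k w)
    (p : Fin m → ℝ) (hp : ∀ j, 0 ≤ p j) (l : Fin n) (t : ℝ) (ht : 0 ≤ t)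
    (hf : ∀ j, w l j ≤ p j + t) (S : Finset (Fin m)) :
    Mk.v l S ≤ ∑ j ∈ S, p j + (k l : ℝ) * t := by
  obtain ⟨U, hU, hc, he⟩ := (hr l S).1
  rw [he]
  refine (w_sum_le (k l) (w l) p t ht hf U hc).trans ?_
  have := Finset.sum_le_sum_of_subset_of_nonneg hU fun j _ _ => hp j
  linarith

theorem cbe_from_dual (hm : 1 ≤ m) (Mk : Market n m) (k : Fin n → ℕ) (w : Fin n → Fin m → ℝ)
    (hr : IsRank Mk k w) (k' : Fin n → ℕ) (C : Finset (Fin n)) (hC : C.Nonempty)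
    (hk : ∀ l ∈ C, k' l = k l) (A : Fin n → Finset (Fin m))
    (p : Fin m → ℝ) (τ : Fin n → ℝ) (hp : ∀ j, 0 ≤ p j) (hτ : ∀ l, 0 ≤ τ l)
    (hf : ∀ l j, w l j ≤ p j + τ l) (hc : ∀ l, (A l).card ≤ k' l)
    (hd : ∀ l l', l ≠ l' → Disjoint (A l) (A l'))
    (ht : ∑ j, p j + ∑ l, (k' l : ℝ) * τ l ≤ ∑ l, ∑ j ∈ A l, w l j)
    (hne : ∀ l ∈ C, (A l).Nonempty) (hem : ∀ l, l ∉ C → A l = ∅)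
    (Q : ℝ) (hQ : 0 ≤ Q) (hQl : ∀ l ∈ C, Q ≤ (k l : ℝ) * τ l) :
    ∃ E : CBE Mk, (C.card : ℝ) * Q + ∑ j, p j ≤ E.revenue := by
  obtain ⟨hs, hz⟩ := dual_slack k' w A p τ hp hτ hf hc hd ht
  refine start hm Mk C hC A hne (fun l _ l' _ h => hd l l' h) p hp (fun j hj => hz j fun l => ?_)
    Q hQ (fun l => (k l : ℝ) * τ l) hQl (fun l hl => ?_) (fun l hl S => ?_)
  · by_cases hl : l ∈ C
    · exact hj l hl
    · simp [hem l hl]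
  · have h1 := hs l
    rw [hk l hl] at h1
    have h2 : ∑ j ∈ A l, w l j ≤ Mk.v l (A l) :=
      (hr l (A l)).2 ⟨A l, subset_rfl, by rw [← hk l hl]; exact hc l, rfl⟩
    show (k l : ℝ) * τ l ≤ _
    linarith
  · have := v_le Mk k w hr p hp l (τ l) (hτ l) (hf l) S
    show _ ≤ (k l : ℝ) * τ l
    linarith

theorem trivial_cbe (hn : 1 ≤ n) (hm : 1 ≤ m) (Mk : Market n m) :
    ∃ E : CBE Mk, 0 ≤ E.revenue := by
  obtain ⟨E, hE⟩ := start hm Mk {⟨0, hn⟩} (by simp) (fun _ => univ)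
    (fun _ _ => ⟨⟨0, hm⟩, mem_univ _⟩)
    (fun l hl l' hl' h => absurd ((mem_singleton.1 hl).trans (mem_singleton.1 hl').symm) h)
    (fun _ => 0) (fun _ => le_rfl) (fun _ _ => rfl) 0 le_rfl
    (fun l => Mk.v l univ)
    (fun l _ => by
      show 0 ≤ Mk.v l univ
      rw [← Mk.v_empty l]; exact Mk.v_mono l _ _ (Finset.subset_univ _))
    (fun l _ => by simp)
    (fun l _ S => by simpa using Mk.v_mono l _ _ (Finset.subset_univ S))
  exact ⟨E, by simpa using hE⟩

theorem main_bound (hn : 1 ≤ n) (hm : 1 ≤ m) (Mk : Market n m) (k : Fin n → ℕ)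
    (w : Fin n → Fin m → ℝ) (hw : ∀ l j, 0 ≤ w l j) (hr : IsRank Mk k w) :
    ∃ E : CBE Mk, E.revenue ≥ (1 / 2) * OPT Mk / (Real.logb 2 (min n m : ℕ) + 2) := by
  classical
  have hμ : 1 ≤ min n m := le_min hn hm
  set L := Real.logb 2 ((min n m : ℕ) : ℝ) with hL
  have hL0 : 0 ≤ L := Real.logb_nonneg (by norm_num) (by exact_mod_cast hμ)
  obtain ⟨A, p, τ, hp, hτ, hf, hc, hd, ht⟩ := market_dual hm k w hw
  obtain ⟨hs, hz⟩ := dual_slack k w A p τ hp hτ hf hc hd ht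
  have hopt : OPT Mk ≤ ∑ j, p j + ∑ l, (k l : ℝ) * τ l := by
    unfold OPT
    refine csSup_le ⟨_, fun _ => ∅, fun _ _ _ => disjoint_empty_left _, rfl⟩ ?_
    rintro x ⟨S, hS, rfl⟩
    unfold allocWelfare
    have h1 : ∑ l, Mk.v l (S l) ≤ ∑ l, (∑ j ∈ S l, p j + (k l : ℝ) * τ l) :=
      Finset.sum_le_sum fun l _ => v_le Mk k w hr p hp l (τ l) (hτ l) (hf l) (S l)
    rw [Finset.sum_add_distrib, sum_disj_le S hS] at h1
    have h2 : ∑ j ∈ univ.biUnion S, p j ≤ ∑ j, p j :=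
      Finset.sum_le_sum_of_subset_of_nonneg (Finset.subset_univ _) fun j _ _ => hp j
    linarith
  by_cases hopt0 : OPT Mk ≤ 0
  · obtain ⟨E, hE⟩ := trivial_cbe hn hm Mk
    refine ⟨E, le_trans ?_ hE⟩
    exact div_nonpos_of_nonpos_of_nonneg (by linarith) (by linarith)
  push Not at hopt0
  by_cases hcase : OPT Mk / 2 ≤ ∑ j, p j
  · let C : Finset (Fin n) := univ.filter fun l => (A l).Nonempty
    have hCne : C.Nonempty := by
      by_contra h
      have h1 : ∀ l, A l = ∅ := by
        intro l
        by_contra hl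
        exact h ⟨l, by simpa [C] using Finset.nonempty_iff_ne_empty.2 hl⟩
      have : ∑ j, p j = 0 := Finset.sum_eq_zero fun j _ => hz j fun l => by simp [h1 l]
      linarith
    obtain ⟨E, hE⟩ := cbe_from_dual hm Mk k w hr k C hCne (fun _ _ => rfl) A p τ hp hτ hf hc hd ht
      (fun l hl => by simpa [C] using hl)
      (fun l hl => by simpa [C] using hl) 0 le_rfl
      (fun l _ => mul_nonneg (Nat.cast_nonneg _) (hτ l))
    refine ⟨E, ?_⟩
    rw [ge_iff_le, div_le_iff₀ (by linarith)]
    nlinarith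
  · push Not at hcase
    let b : Fin n → ℝ := fun l => (k l : ℝ) * τ l
    have hb0 : ∀ l, 0 ≤ b l := fun l => mul_nonneg (Nat.cast_nonneg _) (hτ l)
    let s : Finset (Fin n) := univ.filter fun l => 0 < b l
    have hsb : ∑ l ∈ s, b l = ∑ l, b l := by
      refine Finset.sum_subset (Finset.subset_univ _) fun l _ hl => ?_
      simp only [s, mem_filter, mem_univ, true_and, not_lt] at hl
      exact le_antisymm hl (hb0 l)
    have hbig : OPT Mk / 2 ≤ ∑ l ∈ s, b l := by
      rw [hsb]
      have : ∑ l, b l = ∑ l, (k l : ℝ) * τ l := rfl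
      linarith
    have hsne : s.Nonempty := by
      by_contra h
      rw [Finset.not_nonempty_iff_eq_empty] at h
      rw [h, Finset.sum_empty] at hbig
      linarith
    have hAs : ∀ l ∈ s, (A l).Nonempty := by
      intro l hl
      by_contra h
      rw [Finset.not_nonempty_iff_eq_empty] at h
      have h1 := hs l
      rw [h] at h1
      simp only [s, mem_filter, mem_univ, true_and, b] at hl
      simp only [Finset.sum_empty, sub_zero] at h1
      linarith
    have hN : s.card ≤ min n m := by
      refine le_min (by simpa using Finset.card_le_univ s) ?_
      refine (Finset.card_le_card_biUnion (f := A) (fun a _ b _ h => hd a b h) hAs).trans ?_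
      simpa using Finset.card_le_univ (s.biUnion A)
    obtain ⟨i, hi, hmax⟩ := Finset.exists_max_image s
      (fun i => b i * ((s.filter fun j => b i ≤ b j).card : ℝ)) hsne
    have hsel := harmonic_select b _ s hmax (fun i _ => hb0 i)
    set Q := b i with hQdef
    have hQ : 0 < Q := by simpa [s] using hi
    let C : Finset (Fin n) := s.filter fun j => Q ≤ b j
    have hiC : i ∈ C := by simp [C, hi, Q]
    have hharm : ((harmonic s.card : ℚ) : ℝ) ≤ 1 + L := by
      refine (harmonic_le_one_add_log s.card).trans ?_
      have h1 : (1 : ℝ) ≤ s.card := by exact_mod_cast Finset.card_pos.2 hsne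
      have h2 : Real.log s.card ≤ Real.log ((min n m : ℕ) : ℝ) :=
        Real.log_le_log (by linarith) (by exact_mod_cast hN)
      have h3 : Real.log ((min n m : ℕ) : ℝ) ≤ L := by
        rw [hL, Real.logb, le_div_iff₀ (Real.log_pos (by norm_num))]
        have h4 : Real.log 2 ≤ 1 := by linarith [Real.log_two_lt_d9]
        have h5 := Real.log_nonneg h1
        nlinarith
      linarith
    let k' : Fin n → ℕ := fun l => if l ∈ C then k l else 0
    obtain ⟨A', p', τ', hp', hτ', hf', hc', hd', ht'⟩ := market_dual hm k' w hw
    let p2 : Fin m → ℝ := fun j => min (p j) (p' j)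
    let τ2 : Fin n → ℝ := fun l => max (τ l) (τ' l)
    have hp2 : ∀ j, 0 ≤ p2 j := fun j => le_min (hp j) (hp' j)
    have hτ2 : ∀ l, 0 ≤ τ2 l := fun l => (hτ l).trans (le_max_left _ _)
    have hf2 : ∀ l j, w l j ≤ p2 j + τ2 l := by
      intro l j
      have h1 := hf l j
      have h2 := hf' l j
      have h3 := le_max_left (τ l) (τ' l)
      have h4 := le_max_right (τ l) (τ' l)
      simp only [p2, τ2]
      rcases min_choice (p j) (p' j) with h | h <;> rw [h] <;> linarith
    have hf3 : ∀ l j, w l j ≤ max (p j) (p' j) + min (τ l) (τ' l) := by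
      intro l j
      have h1 := hf l j
      have h2 := hf' l j
      have h3 := le_max_left (p j) (p' j)
      have h4 := le_max_right (p j) (p' j)
      rcases min_choice (τ l) (τ' l) with h | h <;> rw [h] <;> linarith
    have hwd := weak_dual k w A (fun j => max (p j) (p' j)) (fun l => min (τ l) (τ' l))
      (fun j => (hp j).trans (le_max_left _ _)) (fun l => le_min (hτ l) (hτ' l)) hf3 hc hd
    have hps : ∑ j, p2 j + ∑ j, max (p j) (p' j) = ∑ j, p j + ∑ j, p' j := by
      rw [← Finset.sum_add_distrib, ← Finset.sum_add_distrib]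
      exact Finset.sum_congr rfl fun j _ => min_add_max _ _
    have hts : ∑ l, (k' l : ℝ) * τ2 l + ∑ l, (k l : ℝ) * min (τ l) (τ' l)
        ≤ ∑ l, (k' l : ℝ) * τ' l + ∑ l, (k l : ℝ) * τ l := by
      rw [← Finset.sum_add_distrib, ← Finset.sum_add_distrib]
      refine Finset.sum_le_sum fun l _ => ?_
      simp only [k', τ2]
      have hk0 : (0 : ℝ) ≤ k l := Nat.cast_nonneg _
      split_ifs
      · have := max_add_min (τ l) (τ' l)
        rw [← mul_add, this, ← mul_add, add_comm]
      · have := mul_le_mul_of_nonneg_left (min_le_left (τ l) (τ' l)) hk0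
        simp only [Nat.cast_zero, zero_mul, zero_add]
        exact this
    have ht2 : ∑ j, p2 j + ∑ l, (k' l : ℝ) * τ2 l ≤ ∑ l, ∑ j ∈ A' l, w l j := by
      linarith
    obtain ⟨hs2, -⟩ := dual_slack k' w A' p2 τ2 hp2 hτ2 hf2 hc' hd' ht2
    have hQl : ∀ l ∈ C, Q ≤ (k l : ℝ) * τ2 l := by
      intro l hl
      have h1 : Q ≤ b l := (mem_filter.1 hl).2
      have h2 : b l ≤ (k l : ℝ) * τ2 l :=
        mul_le_mul_of_nonneg_left (le_max_left _ _) (Nat.cast_nonneg _)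
      exact h1.trans h2
    have hkC : ∀ l ∈ C, k' l = k l := fun l hl => by simp only [k']; rw [if_pos hl]
    obtain ⟨E, hE⟩ := cbe_from_dual hm Mk k w hr k' C ⟨i, hiC⟩ hkC A' p2 τ2 hp2 hτ2 hf2 hc' hd' ht2
      (fun l hl => by
        by_contra h
        rw [Finset.not_nonempty_iff_eq_empty] at h
        have h1 := hs2 l
        rw [h, hkC l hl] at h1
        simp only [Finset.sum_empty, sub_zero] at h1
        have := hQl l hl
        linarith)
      (fun l hl => by
        have h1 := hc' l
        simp only [k'] at h1
        rw [if_neg hl] at h1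
        exact Finset.card_eq_zero.1 (Nat.le_zero.1 h1))
      Q hQ.le hQl
    refine ⟨E, ?_⟩
    have h1 : 0 ≤ ∑ j, p2 j := Finset.sum_nonneg fun j _ => hp2 j
    have h2 : Q * (C.card : ℝ) ≤ E.revenue := by linarith
    have h3 : ∑ l ∈ s, b l ≤ Q * (C.card : ℝ) * ((harmonic s.card : ℚ) : ℝ) := hsel
    have h4 : 0 ≤ Q * (C.card : ℝ) := mul_nonneg hQ.le (Nat.cast_nonneg _)
    have h5 := mul_le_mul_of_nonneg_left hharm h4
    rw [ge_iff_le, div_le_iff₀ (by linarith)]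
    have h6 : Q * (C.card : ℝ) * (1 + L) ≤ E.revenue * (L + 2) :=
      mul_le_mul h2 (by linarith) (by linarith) (h4.trans h2)
    linarith

end FIN

/-- There is an absolute constant `c > 0` such that every market in which
each valuation is a weighted rank function of a uniform matroid admits a CBE with
revenue at least `c * OPT / (log₂ μ + 2)`, `μ = min n m`. -/
theorem uniform_matroid_revenue :
    ∃ c : ℝ, 0 < c ∧
      ∀ (n m : ℕ), 1 ≤ n → 1 ≤ m → ∀ (Mk : Market n m),
        (∀ i : Fin n, ∃ (k : ℕ) (w : Fin m → ℝ), (∀ j, 0 ≤ w j) ∧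
          ∀ S : Finset (Fin m),
            IsGreatest {x : ℝ | ∃ U ⊆ S, U.card ≤ k ∧ x = ∑ j ∈ U, w j} (Mk.v i S)) →
        ∃ E : CBE Mk, E.revenue ≥ c * OPT Mk / (Real.logb 2 (min n m : ℕ) + 2) := by

  refine ⟨1 / 2, by norm_num, fun n m hn hm Mk h => ?_⟩
  choose k w hw hr using h
  exact main_bound hn hm Mk k w hw hr
end

section
/- There exists an absolute constant c > 0 such that for every matroid ℳ on ground set M, every combinatorial market in which each consumer's valuation is a weighted rank function of the common matroid ℳ (with possibly different weights per consumer) admits a competitive bundling equilibrium whose revenue is at least c · OPT / (log(μ) + 2), where μ = min{n, m}. -/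
open Finset

lemma cmr_exchange {m : ℕ} (ℳ : Matroid (Fin m)) (hE : ℳ.E = Set.univ)
    (I J : Finset (Fin m)) (hI : ℳ.Indep (I : Set (Fin m))) (hJ : ℳ.Indep (J : Set (Fin m)))
    (e : Fin m) (heJ : e ∈ J) (heI : e ∉ I) :
    ℳ.Indep ((insert e I : Finset (Fin m)) : Set (Fin m)) ∨
    ∃ f ∈ I, f ∉ J ∧ ℳ.Indep ((insert e (I.erase f) : Finset (Fin m)) : Set (Fin m)) ∧
      ℳ.Indep ((insert f (J.erase e) : Finset (Fin m)) : Set (Fin m)) := by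
  by_cases h : ℳ.Indep ((insert e I : Finset (Fin m)) : Set (Fin m))
  · exact Or.inl h
  right
  have heI' : e ∉ (I : Set (Fin m)) := by simpa using heI
  have hcl : e ∈ ℳ.closure (I : Set (Fin m)) := by
    by_contra hc
    apply h
    rw [Finset.coe_insert]
    rw [hI.insert_indep_iff]
    left
    exact ⟨by rw [hE]; trivial, hc⟩
  have hC := hI.fundCircuit_isCircuit hcl heI'
  have heC := ℳ.mem_fundCircuit e (I : Set (Fin m))
  have h1 := hC.mem_closure_sdiff_singleton_of_mem heC
  have h2 := hJ.notMem_closure_sdiff_of_mem (show e ∈ (J : Set (Fin m)) by simpa using heJ)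
  have h3 : ¬ (ℳ.fundCircuit e (I : Set (Fin m)) \ {e} ⊆ ℳ.closure ((J : Set (Fin m)) \ {e})) := by
    intro hs
    exact h2 (ℳ.closure_subset_closure_of_subset_closure hs h1)
  obtain ⟨f, hf, hfn⟩ := Set.not_subset.1 h3
  have hfI : f ∈ (I : Set (Fin m)) := by
    have := ℳ.fundCircuit_subset_insert e (I : Set (Fin m)) hf.1
    rcases this with h | h
    · exact absurd h hf.2
    · exact h
  have hfe : f ≠ e := hf.2
  have hJe : ℳ.Indep ((J : Set (Fin m)) \ {e}) := hJ.subset Set.sdiff_subset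
  have hfJ : f ∉ J := by
    intro hfJ
    exact hfn (ℳ.subset_closure _ (by rw [hE]; exact Set.subset_univ _) ⟨by simpa using hfJ, hfe⟩)
  refine ⟨f, by simpa using hfI, hfJ, ?_, ?_⟩
  · have := (hI.mem_fundCircuit_iff hcl heI').1 hf.1
    refine this.subset ?_
    intro x hx
    simp at hx ⊢
    rcases hx with rfl | hx
    · exact ⟨Or.inl rfl, fun h => hfe h.symm⟩
    · exact ⟨Or.inr hx.1, hx.2⟩
  · rw [Finset.coe_insert, Finset.coe_erase, hJe.insert_indep_iff]
    left
    exact ⟨by rw [hE]; trivial, hfn⟩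

/-- approximate demand -/
def CmrOpt {m : ℕ} (ℳ : Matroid (Fin m)) (ε : ℝ) (a : Fin m → ℝ) (S : Finset (Fin m)) : Prop :=
  ℳ.Indep (S : Set (Fin m)) ∧ ∀ U : Finset (Fin m), ℳ.Indep (U : Set (Fin m)) →
    ∑ j ∈ U, a j - ε * ((U \ S).card : ℝ) ≤ ∑ j ∈ S, a j

lemma cmr_cand {m : ℕ} (ℳ : Matroid (Fin m)) (hE : ℳ.E = Set.univ) (ε : ℝ)
    (a : Fin m → ℝ) (S : Finset (Fin m)) (hS : CmrOpt ℳ ε a S) (e : Fin m) (he : e ∉ S)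
    (U : Finset (Fin m)) (hU : ℳ.Indep (U : Set (Fin m))) (heU : e ∈ U) :
    ∃ S' : Finset (Fin m), S' ⊆ insert e S ∧ ℳ.Indep (S' : Set (Fin m)) ∧ e ∈ S' ∧
      ∑ j ∈ U, a j - ε * (((U \ S).card : ℝ) - 1) ≤ ∑ j ∈ S', a j := by
  have hcard : ((((U.erase e) \ S).card : ℕ) : ℝ) = ((U \ S).card : ℝ) - 1 := by
    have : (U.erase e) \ S = (U \ S).erase e := by
      ext x; simp; tauto
    rw [this, Finset.card_erase_of_mem (by simp [heU, he])]
    have : 1 ≤ (U \ S).card := Finset.card_pos.2 ⟨e, by simp [heU, he]⟩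
    push_cast [this]
    ring
  have hsum := Finset.add_sum_erase U a heU
  rcases cmr_exchange ℳ hE S U hS.1 hU e heU he with h | ⟨f, hfS, hfU, h1, h2⟩
  · refine ⟨insert e S, subset_rfl, h, by simp, ?_⟩
    rw [Finset.sum_insert he]
    have := hS.2 (U.erase e) (hU.subset (by simp))
    rw [hcard] at this
    linarith
  · refine ⟨insert e (S.erase f), Finset.insert_subset_insert _ (Finset.erase_subset _ _), h1,
      by simp, ?_⟩
    rw [Finset.sum_insert (by simp [he])]
    have h3 := Finset.add_sum_erase S a hfS
    have := hS.2 _ h2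
    rw [Finset.insert_sdiff_of_mem _ hfS, hcard, Finset.sum_insert (by simp [hfU])] at this
    linarith

lemma cmr_improve {m : ℕ} (ℳ : Matroid (Fin m)) (hE : ℳ.E = Set.univ) (ε : ℝ) (hε : 0 < ε)
    (a : Fin m → ℝ) (S : Finset (Fin m)) (hS : CmrOpt ℳ ε a S) (e : Fin m) (he : e ∉ S)
    (hn : ¬ CmrOpt ℳ ε (Function.update a e (a e + ε)) S) :
    ∃ S' : Finset (Fin m), S' ⊆ insert e S ∧ CmrOpt ℳ ε a S' ∧
      ∑ j ∈ S, a j < ∑ j ∈ S', a j := by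
  classical
  have hn' : ∃ U : Finset (Fin m), ℳ.Indep (U : Set (Fin m)) ∧
      ∑ j ∈ S, (Function.update a e (a e + ε)) j <
        ∑ j ∈ U, (Function.update a e (a e + ε)) j - ε * ((U \ S).card : ℝ) := by
    by_contra hc
    push Not at hc
    exact hn ⟨hS.1, hc⟩
  obtain ⟨U, hU, hlt⟩ := hn'
  rw [Finset.sum_update_of_notMem he] at hlt
  have heU : e ∈ U := by
    by_contra hc
    rw [Finset.sum_update_of_notMem hc] at hlt
    linarith [hS.2 U hU]
  rw [Finset.sum_update_of_mem heU, ← Finset.erase_eq] at hlt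
  have hsum := Finset.add_sum_erase U a heU
  obtain ⟨S0, h1, h2, h3, h4⟩ := cmr_cand ℳ hE ε a S hS e he U hU heU
  obtain ⟨S', hS', hmax⟩ := Finset.exists_max_image
    ((insert e S).powerset.filter fun X : Finset (Fin m) => ℳ.Indep (X : Set (Fin m)) ∧ e ∈ X)
    (fun X => ∑ j ∈ X, a j) ⟨S0, by simp [h1, h2, h3]⟩
  simp only [Finset.mem_filter, Finset.mem_powerset] at hS' hmax
  obtain ⟨hsub, hind, heS'⟩ := hS'
  have hgt : ∑ j ∈ S, a j < ∑ j ∈ S', a j := by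
    have := hmax S0 ⟨h1, h2, h3⟩
    linarith
  refine ⟨S', hsub, ⟨hind, ?_⟩, hgt⟩
  intro V hV
  by_cases heV : e ∈ V
  · obtain ⟨S1, k1, k2, k3, k4⟩ := cmr_cand ℳ hE ε a S hS e he V hV heV
    have h5 := hmax S1 ⟨k1, k2, k3⟩
    have h6 : (V \ S).card ≤ (V \ S').card + 1 := by
      have : V \ S ⊆ insert e (V \ S') := by
        intro x hx
        simp only [Finset.mem_sdiff, Finset.mem_insert] at hx ⊢
        by_cases hxe : x = e
        · exact Or.inl hxe
        · refine Or.inr ⟨hx.1, fun hx' => ?_⟩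
          have := hsub hx'
          simp only [Finset.mem_insert] at this
          tauto
      exact (Finset.card_le_card this).trans (Finset.card_insert_le _ _)
    have h7 : ((V \ S).card : ℝ) - 1 ≤ ((V \ S').card : ℝ) := by
      have : ((V \ S).card : ℝ) ≤ ((V \ S').card : ℝ) + 1 := by exact_mod_cast h6
      linarith
    have := mul_le_mul_of_nonneg_left h7 hε.le
    linarith
  · have h6 : (V \ S).card ≤ (V \ S').card := by
      apply Finset.card_le_card
      intro x hx
      simp only [Finset.mem_sdiff] at hx ⊢
      refine ⟨hx.1, fun hx' => ?_⟩
      have := hsub hx'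
      simp only [Finset.mem_insert] at this
      rcases this with rfl | h
      · exact heV hx.1
      · exact hx.2 h
    have h7 : ((V \ S).card : ℝ) ≤ ((V \ S').card : ℝ) := by exact_mod_cast h6
    have := mul_le_mul_of_nonneg_left h7 hε.le
    linarith [hS.2 V hV]

lemma cmr_limit {Z ι : Type*} [Finite Z] [Fintype ι] (B : ℝ) (C : Z → ℝ → (ι → ℝ) → Prop)
    (h : ∀ ε : ℝ, 0 < ε → ε ≤ 1 → ∃ z x, (∀ i, |x i| ≤ B) ∧ C z ε x) :
    ∃ (z : Z) (x : ι → ℝ) (e : ℕ → ℝ) (y : ℕ → ι → ℝ),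
      Filter.Tendsto e Filter.atTop (nhds 0) ∧
      (∀ i, Filter.Tendsto (fun k => y k i) Filter.atTop (nhds (x i))) ∧
      (∀ k, 0 < e k ∧ C z (e k) (y k)) := by
  have h' : ∀ k : ℕ, ∃ zx : Z × (ι → ℝ), (∀ i, |zx.2 i| ≤ B) ∧ C zx.1 (1 / ((k : ℝ) + 1)) zx.2 := by
    intro k
    obtain ⟨z, x, hx⟩ := h (1 / ((k : ℝ) + 1)) (by positivity) (by
      rw [div_le_one (by positivity)]
      have : (0 : ℝ) ≤ k := by positivity
      linarith)
    exact ⟨(z, x), hx⟩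
  choose zx hb hC using h'
  obtain ⟨z, hz⟩ := Finite.exists_infinite_fiber (fun k => (zx k).1)
  have hinf : ((fun k => (zx k).1) ⁻¹' {z}).Infinite := Set.infinite_coe_iff.1 hz
  let φ := Nat.nth (fun k => k ∈ ((fun k => (zx k).1) ⁻¹' {z}))
  have hφ : StrictMono φ := Nat.nth_strictMono hinf
  have hφz : ∀ k, (zx (φ k)).1 = z := fun k => Nat.nth_mem_of_infinite hinf k
  have hcomp : IsCompact (Set.pi Set.univ (fun _ : ι => Set.Icc (-B) B)) :=
    isCompact_univ_pi (fun _ => isCompact_Icc)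
  obtain ⟨x, -, ψ, hψ, hlim⟩ := hcomp.tendsto_subseq (x := fun k => (zx (φ k)).2)
    (fun k i _ => by simpa [abs_le] using hb (φ k) i)
  refine ⟨z, x, fun k => 1 / (((φ (ψ k) : ℕ) : ℝ) + 1), fun k => (zx (φ (ψ k))).2, ?_, ?_, ?_⟩
  · exact tendsto_one_div_add_atTop_nhds_zero_nat.comp (hφ.comp hψ).tendsto_atTop
  · intro i
    exact (tendsto_pi_nhds.1 hlim) i
  · intro k
    refine ⟨by positivity, ?_⟩
    have := hC (φ (ψ k))
    rwa [hφz] at this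

/-- approximate Walrasian state for the consumers in `P` -/
def CmrValid {n m : ℕ} (ℳ : Matroid (Fin m)) (w : Fin n → Fin m → ℝ) (ε : ℝ)
    (P : Finset (Fin n)) (p : Fin m → ℝ) (S : Fin n → Finset (Fin m)) : Prop :=
  IsAllocation S ∧ (∀ i, i ∉ P → S i = ∅) ∧
    ∀ i ∈ P, CmrOpt ℳ ε (fun j => w i j - p j) (S i)

lemma cmr_we_eps {n m : ℕ} (ℳ : Matroid (Fin m)) (hE : ℳ.E = Set.univ)
    (w : Fin n → Fin m → ℝ) (P : Finset (Fin n)) (p0 : Fin m → ℝ) (hp0 : ∀ j, 0 ≤ p0 j)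
    (S0 : Fin n → Finset (Fin m)) (h0 : CmrValid ℳ w 0 P p0 S0) (ε : ℝ) (hε : 0 < ε) :
    ∃ (S : Fin n → Finset (Fin m)) (p : Fin m → ℝ), (∀ j, 0 ≤ p j ∧ p j ≤ p0 j) ∧
      CmrValid ℳ w ε P p S ∧ ∀ e, (∀ i, e ∉ S i) → p e ≤ ε := by
  classical
  have h0' : CmrValid ℳ w ε P p0 S0 := by
    refine ⟨h0.1, h0.2.1, fun i hi => ⟨(h0.2.2 i hi).1, fun U hU => ?_⟩⟩
    have := (h0.2.2 i hi).2 U hU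
    have h2 : 0 ≤ ε * ((U \ S0 i).card : ℝ) := by positivity
    linarith
  let X : Set ℝ := {x | ∃ p S, (∀ j, 0 ≤ p j ∧ p j ≤ p0 j) ∧ CmrValid ℳ w ε P p S ∧ x = ∑ j, p j}
  have hX : X.Nonempty := ⟨_, p0, S0, fun j => ⟨hp0 j, le_rfl⟩, h0', rfl⟩
  have hXb : BddBelow X := by
    refine ⟨0, ?_⟩
    rintro x ⟨p, S, hp, -, rfl⟩
    exact Finset.sum_nonneg fun j _ => (hp j).1
  obtain ⟨x, ⟨p, S1, hp, hv1, rfl⟩, hlt⟩ := exists_lt_of_csInf_lt hX (show sInf X < sInf X + ε by linarith)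
  obtain ⟨S, hS, hmax⟩ := Finset.exists_max_image
    (Finset.univ.filter fun S : Fin n → Finset (Fin m) => CmrValid ℳ w ε P p S)
    (fun S => ∑ i ∈ P, ∑ j ∈ S i, (w i j - p j)) ⟨S1, by simp [hv1]⟩
  simp only [Finset.mem_filter, Finset.mem_univ, true_and] at hS hmax
  refine ⟨S, p, hp, hS, ?_⟩
  intro e he
  by_contra hc
  push Not at hc
  by_cases hv : CmrValid ℳ w ε P (Function.update p e (p e - ε)) S
  · have hmem : (∑ j, Function.update p e (p e - ε) j) ∈ X := by
      refine ⟨_, S, ?_, hv, rfl⟩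
      intro j
      by_cases hj : j = e
      · subst hj
        simp only [Function.update_self]
        exact ⟨by linarith, by linarith [(hp j).2]⟩
      · simp only [Function.update_of_ne hj]
        exact hp j
    have h1 := csInf_le hXb hmem
    rw [Finset.sum_update_of_mem (Finset.mem_univ e), ← Finset.erase_eq] at h1
    have := Finset.add_sum_erase Finset.univ p (Finset.mem_univ e)
    linarith
  · have : ∃ i ∈ P, ¬ CmrOpt ℳ ε (fun j => w i j - Function.update p e (p e - ε) j) (S i) := by
      by_contra hc2
      push Not at hc2
      exact hv ⟨hS.1, hS.2.1, hc2⟩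
    obtain ⟨i, hi, hno⟩ := this
    have heq : (fun j => w i j - Function.update p e (p e - ε) j) =
        Function.update (fun j => w i j - p j) e ((fun j => w i j - p j) e + ε) := by
      funext j
      by_cases hj : j = e
      · subst hj
        simp only [Function.update_self]
        ring
      · simp only [Function.update_of_ne hj]
    rw [heq] at hno
    obtain ⟨S', hsub, hopt, hgt⟩ := cmr_improve ℳ hE ε hε _ (S i) (hS.2.2 i hi) e (he i) hno
    have hnew : CmrValid ℳ w ε P p (Function.update S i S') := by
      have hdis : ∀ k, k ≠ i → Disjoint S' (S k) := by
        intro k hk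
        refine Finset.disjoint_of_subset_left hsub ?_
        rw [Finset.disjoint_insert_left]
        exact ⟨he k, hS.1 i k hk.symm⟩
      refine ⟨?_, ?_, ?_⟩
      · intro a b hab
        by_cases ha : a = i
        · subst ha
          rw [Function.update_self, Function.update_of_ne hab.symm]
          exact hdis b hab.symm
        · rw [Function.update_of_ne ha]
          by_cases hb : b = i
          · subst hb
            rw [Function.update_self]
            exact (hdis a ha).symm
          · rw [Function.update_of_ne hb]
            exact hS.1 a b hab
      · intro k hk
        rw [Function.update_of_ne (fun h : k = i => hk (h ▸ hi))]
        exact hS.2.1 k hk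
      · intro k hk
        by_cases hki : k = i
        · subst hki
          rw [Function.update_self]
          exact hopt
        · rw [Function.update_of_ne hki]
          exact hS.2.2 k hk
    have h1 := hmax _ hnew
    have h2 : ∑ k ∈ P, ∑ j ∈ S k, (w k j - p j) <
        ∑ k ∈ P, ∑ j ∈ (Function.update S i S') k, (w k j - p j) := by
      apply Finset.sum_lt_sum
      · intro k hk
        by_cases hki : k = i
        · subst hki
          rw [Function.update_self]
          exact hgt.le
        · rw [Function.update_of_ne hki]
      · exact ⟨i, hi, by rw [Function.update_self]; exact hgt⟩
    linarith

lemma cmr_we {n m : ℕ} (ℳ : Matroid (Fin m)) (hE : ℳ.E = Set.univ)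
    (w : Fin n → Fin m → ℝ) (P : Finset (Fin n)) (p0 : Fin m → ℝ) (hp0 : ∀ j, 0 ≤ p0 j)
    (S0 : Fin n → Finset (Fin m)) (h0 : CmrValid ℳ w 0 P p0 S0) :
    ∃ (S : Fin n → Finset (Fin m)) (p : Fin m → ℝ), (∀ j, 0 ≤ p j ∧ p j ≤ p0 j) ∧
      CmrValid ℳ w 0 P p S ∧ ∀ e, (∀ i, e ∉ S i) → p e = 0 := by
  classical
  obtain ⟨S, p, e, y, he, hy, hC⟩ := cmr_limit (Z := Fin n → Finset (Fin m)) (ι := Fin m)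
    (∑ j, p0 j)
    (fun S ε p => (∀ j, 0 ≤ p j ∧ p j ≤ p0 j) ∧
      CmrValid ℳ w ε P p S ∧ ∀ e, (∀ i, e ∉ S i) → p e ≤ ε) (by
    intro ε hε _
    obtain ⟨S, p, h1, h2⟩ := cmr_we_eps ℳ hE w P p0 hp0 S0 h0 ε hε
    refine ⟨S, p, fun i => ?_, h1, h2⟩
    rw [abs_of_nonneg (h1 i).1]
    exact (h1 i).2.trans (Finset.single_le_sum (fun j _ => hp0 j) (Finset.mem_univ i)))
  have hp : ∀ j, 0 ≤ p j ∧ p j ≤ p0 j := fun j =>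
    ⟨ge_of_tendsto' (hy j) (fun k => ((hC k).2.1 j).1),
      le_of_tendsto' (hy j) (fun k => ((hC k).2.1 j).2)⟩
  have hsum : ∀ i (U : Finset (Fin m)), Filter.Tendsto (fun k => ∑ j ∈ U, (w i j - y k j))
      Filter.atTop (nhds (∑ j ∈ U, (w i j - p j))) := fun i U =>
    tendsto_finsetSum _ (fun j _ => tendsto_const_nhds.sub (hy j))
  refine ⟨S, p, hp, ⟨(hC 0).2.2.1.1, (hC 0).2.2.1.2.1, fun i hi =>
    ⟨((hC 0).2.2.1.2.2 i hi).1, fun U hU => ?_⟩⟩, fun a ha => ?_⟩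
  · exact le_of_tendsto_of_tendsto' ((hsum i U).sub (he.mul_const _)) (hsum i (S i))
      (fun k => ((hC k).2.2.1.2.2 i hi).2 U hU)
  · exact le_antisymm (le_of_tendsto_of_tendsto' (hy a) he (fun k => (hC k).2.2.2 a ha)) (hp a).1

/-- states with one bundle per consumer, approximately stable for the holders of a bundle -/
def CmrSt {n m : ℕ} (Mk : Market n m) (ε : ℝ) (Z : Fin n → Finset (Fin m)) (π : Fin n → ℝ) :
    Prop :=
  IsAllocation Z ∧ (∀ e, ∃ i, e ∈ Z i) ∧ (∀ i, 0 ≤ π i) ∧ (∀ i, Z i = ∅ → π i = 0) ∧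
    ∀ i, Z i ≠ ∅ → ∀ T : Finset (Fin n),
      Mk.v i (T.biUnion Z) - ∑ l ∈ T, π l ≤ Mk.v i (Z i) - π i + ε

lemma cmr_nonneg {n m : ℕ} (Mk : Market n m) (i : Fin n) (S : Finset (Fin m)) : 0 ≤ Mk.v i S := by
  have := Mk.v_mono i ∅ S (Finset.empty_subset _)
  rwa [Mk.v_empty] at this

lemma cmr_st_bound {n m : ℕ} (Mk : Market n m) (ε : ℝ) (hε1 : ε ≤ 1)
    (Z : Fin n → Finset (Fin m)) (π : Fin n → ℝ) (h : CmrSt Mk ε Z π) (i : Fin n) :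
    π i ≤ ∑ l, Mk.v l Finset.univ + 1 := by
  have h1 : Mk.v i Finset.univ ≤ ∑ l, Mk.v l Finset.univ :=
    Finset.single_le_sum (f := fun l => Mk.v l Finset.univ)
      (fun l _ => cmr_nonneg Mk l _) (Finset.mem_univ i)
  have h2 := cmr_nonneg Mk i Finset.univ
  by_cases hZ : Z i = ∅
  · rw [h.2.2.2.1 i hZ]
    linarith
  · have h3 := h.2.2.2.2 i hZ ∅
    simp only [Finset.biUnion_empty, Mk.v_empty, Finset.sum_empty] at h3
    have h4 := Mk.v_mono i (Z i) Finset.univ (Finset.subset_univ _)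
    linarith

lemma cmr_merge_step {n m : ℕ} (Mk : Market n m) (ε : ℝ) (hε : 0 < ε)
    (Z : Fin n → Finset (Fin m)) (π : Fin n → ℝ) (h : CmrSt Mk ε Z π) (j : Fin n)
    (T0 : Finset (Fin n))
    (hv : Mk.v j (Z j) - π j + ε < Mk.v j (T0.biUnion Z) - ∑ l ∈ T0, π l) :
    ∃ Z' π', CmrSt Mk ε Z' π' ∧ ∑ l, π' l = ∑ l, π l + ε := by
  classical
  obtain ⟨hal, hcov, hpos, hemp, hst⟩ := h
  have hZj : Z j = ∅ := by
    by_contra hc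
    linarith [hst j hc T0]
  have hπj := hemp j hZj
  obtain ⟨T, -, hmax⟩ := Finset.exists_max_image (Finset.univ : Finset (Finset (Fin n)))
    (fun T => Mk.v j (T.biUnion Z) - ∑ l ∈ T, π l) ⟨T0, Finset.mem_univ _⟩
  simp only [Finset.mem_univ, true_implies] at hmax
  set Z' : Fin n → Finset (Fin m) :=
    fun i => if i = j then T.biUnion Z else if i ∈ T then ∅ else Z i with hZ'
  set π' : Fin n → ℝ :=
    fun i => if i = j then ∑ l ∈ T, π l + ε else if i ∈ T then 0 else π i with hπ'
  have hTpos : 0 ≤ ∑ l ∈ T, π l := Finset.sum_nonneg fun l _ => hpos l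
  have key1 : ∀ T' : Finset (Fin n), j ∉ T' →
      T'.biUnion Z' = (T' \ T).biUnion Z ∧ ∑ l ∈ T', π' l = ∑ l ∈ T' \ T, π l := by
    intro T' hj
    have hne : ∀ i ∈ T', i ≠ j := fun i hi hij => hj (hij ▸ hi)
    constructor
    · ext x
      simp only [Finset.mem_biUnion, Finset.mem_sdiff]
      constructor
      · rintro ⟨i, hi, hx⟩
        simp only [hZ', if_neg (hne i hi)] at hx
        by_cases hiT : i ∈ T
        · simp [hiT] at hx
        · rw [if_neg hiT] at hx
          exact ⟨i, ⟨hi, hiT⟩, hx⟩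
      · rintro ⟨i, ⟨hi, hiT⟩, hx⟩
        refine ⟨i, hi, ?_⟩
        simp only [hZ', if_neg (hne i hi), if_neg hiT]
        exact hx
    · rw [Finset.sdiff_eq_filter, Finset.sum_filter]
      refine Finset.sum_congr rfl fun i hi => ?_
      simp only [hπ', if_neg (hne i hi)]
      by_cases hiT : i ∈ T <;> simp [hiT]
  have key2 : ∀ T' : Finset (Fin n), j ∈ T' →
      T'.biUnion Z' = (T' ∪ T).biUnion Z ∧ ∑ l ∈ T', π' l = ∑ l ∈ T' ∪ T, π l + ε := by
    intro T' hj
    obtain ⟨k1, k2⟩ := key1 (T'.erase j) (by simp)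
    constructor
    · rw [← Finset.insert_erase hj, Finset.biUnion_insert, k1]
      have : Z' j = T.biUnion Z := by simp [hZ']
      rw [this]
      ext x
      simp only [Finset.mem_union, Finset.mem_biUnion, Finset.mem_sdiff, Finset.mem_insert]
      constructor
      · rintro (⟨i, hi, hx⟩ | ⟨i, hi, hx⟩)
        · exact ⟨i, Or.inr hi, hx⟩
        · exact ⟨i, Or.inl (Or.inr hi.1), hx⟩
      · rintro ⟨i, hi, hx⟩
        by_cases hiT : i ∈ T
        · exact Or.inl ⟨i, hiT, hx⟩
        · rcases hi with (rfl | hi) | hi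
          · simp [hZj] at hx
          · exact Or.inr ⟨i, ⟨hi, hiT⟩, hx⟩
          · exact absurd hi hiT
    · rw [← Finset.add_sum_erase T' π' hj, k2]
      have h1 : π' j = ∑ l ∈ T, π l + ε := by simp [hπ']
      have h2 : ∑ l ∈ T' ∪ T, π l = ∑ l ∈ T' \ T, π l + ∑ l ∈ T, π l := by
        rw [← Finset.sum_union Finset.sdiff_disjoint, Finset.sdiff_union_self_eq_union]
      have h3 : ∑ l ∈ (T'.erase j) \ T, π l = ∑ l ∈ T' \ T, π l := by
        apply Finset.sum_subset
        · exact Finset.sdiff_subset_sdiff (Finset.erase_subset _ _) subset_rfl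
        · intro x hx hx'
          have : x = j := by
            simp only [Finset.mem_sdiff, Finset.mem_erase] at hx hx'
            by_contra hc
            exact hx' ⟨⟨hc, hx.1⟩, hx.2⟩
          rw [this, hπj]
      rw [h1, h2, h3]
      ring
  have key : ∀ T' : Finset (Fin n), ∃ T'' : Finset (Fin n),
      T'.biUnion Z' = T''.biUnion Z ∧ ∑ l ∈ T'', π l ≤ ∑ l ∈ T', π' l := by
    intro T'
    by_cases hj : j ∈ T'
    · exact ⟨T' ∪ T, (key2 T' hj).1, by rw [(key2 T' hj).2]; linarith⟩
    · exact ⟨T' \ T, (key1 T' hj).1, (key1 T' hj).2.ge⟩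
  have hdj : ∀ b, b ≠ j → Disjoint (Z' j) (Z' b) := by
    intro b hb
    simp only [hZ', if_true, if_neg hb]
    by_cases hbT : b ∈ T
    · simp [hbT]
    · rw [if_neg hbT, Finset.disjoint_biUnion_left]
      intro i hi
      exact hal i b (fun h => hbT (h ▸ hi))
  refine ⟨Z', π', ⟨?_, ?_, ?_, ?_, ?_⟩, ?_⟩
  · intro a b hab
    by_cases ha : a = j
    · subst ha
      exact hdj b hab.symm
    · by_cases hb : b = j
      · subst hb
        exact (hdj a ha).symm
      · simp only [hZ', if_neg ha, if_neg hb]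
        by_cases haT : a ∈ T
        · simp [haT]
        · by_cases hbT : b ∈ T
          · simp [hbT]
          · rw [if_neg haT, if_neg hbT]
            exact hal a b hab
  · intro e
    obtain ⟨i, hi⟩ := hcov e
    by_cases hiT : i ∈ T
    · refine ⟨j, ?_⟩
      simp only [hZ', if_true, Finset.mem_biUnion]
      exact ⟨i, hiT, hi⟩
    · refine ⟨i, ?_⟩
      have : i ≠ j := by
        rintro rfl
        simp [hZj] at hi
      simp only [hZ', if_neg this, if_neg hiT]
      exact hi
  · intro i
    simp only [hπ']
    split_ifs
    · linarith
    · exact le_rfl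
    · exact hpos i
  · intro i hi
    by_cases hij : i = j
    · subst hij
      simp only [hZ', if_true] at hi
      have := hmax T0
      rw [hi, Mk.v_empty] at this
      rw [hZj, Mk.v_empty, hπj] at hv
      linarith
    · simp only [hZ', hπ', if_neg hij] at hi ⊢
      by_cases hiT : i ∈ T
      · simp [hiT]
      · rw [if_neg hiT] at hi ⊢
        exact hemp i hi
  · intro i hi T'
    obtain ⟨T'', e1, e2⟩ := key T'
    rw [e1]
    by_cases hij : i = j
    · subst hij
      simp only [hZ', hπ', if_true]
      simp only [hπ'] at e2
      have := hmax T''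
      linarith
    · by_cases hiT : i ∈ T
      · exact absurd (by simp [hZ', hij, hiT]) hi
      · have z1 : Z' i = Z i := by simp [hZ', hij, hiT]
        have z2 : π' i = π i := by simp [hπ', hij, hiT]
        rw [z1] at hi
        rw [z1, z2]
        have := hst i hi T''
        linarith
  · have := (key2 Finset.univ (Finset.mem_univ j)).2
    rw [this, Finset.union_eq_left.2 (Finset.subset_univ T)]

lemma cmr_merge_eps {n m : ℕ} (Mk : Market n m) (ε : ℝ) (hε : 0 < ε) (hε1 : ε ≤ 1)
    (Z0 : Fin n → Finset (Fin m)) (π0 : Fin n → ℝ) (h0 : CmrSt Mk 0 Z0 π0) :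
    ∃ Z π, CmrSt Mk ε Z π ∧ ∑ l, π0 l ≤ ∑ l, π l ∧ ∀ i, ∀ T : Finset (Fin n),
      Mk.v i (T.biUnion Z) - ∑ l ∈ T, π l ≤ Mk.v i (Z i) - π i + ε := by
  have h0' : CmrSt Mk ε Z0 π0 :=
    ⟨h0.1, h0.2.1, h0.2.2.1, h0.2.2.2.1, fun i hi T => by linarith [h0.2.2.2.2 i hi T]⟩
  let X : Set ℝ := {x | ∃ Z π, CmrSt Mk ε Z π ∧ x = ∑ l, π l ∧ ∑ l, π0 l ≤ ∑ l, π l}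
  have hX : X.Nonempty := ⟨_, Z0, π0, h0', rfl, le_rfl⟩
  have hXb : BddAbove X := by
    refine ⟨∑ i : Fin n, (∑ l, Mk.v l Finset.univ + 1), ?_⟩
    rintro x ⟨Z, π, h, rfl, -⟩
    exact Finset.sum_le_sum fun i _ => cmr_st_bound Mk ε hε1 Z π h i
  obtain ⟨x, ⟨Z, π, hst, rfl, hge⟩, hlt⟩ :=
    exists_lt_of_lt_csSup hX (show sSup X - ε < sSup X by linarith)
  refine ⟨Z, π, hst, hge, ?_⟩
  intro i T
  by_contra hc
  push Not at hc
  obtain ⟨Z', π', h1, h2⟩ := cmr_merge_step Mk ε hε Z π hst i T hc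
  have := le_csSup hXb (show ∑ l, π' l ∈ X from ⟨Z', π', h1, rfl, by linarith⟩)
  linarith

lemma cmr_merge {n m : ℕ} (Mk : Market n m)
    (Z0 : Fin n → Finset (Fin m)) (π0 : Fin n → ℝ) (h0 : CmrSt Mk 0 Z0 π0) :
    ∃ Z π, CmrSt Mk 0 Z π ∧ ∑ l, π0 l ≤ ∑ l, π l ∧ ∀ i, ∀ T : Finset (Fin n),
      Mk.v i (T.biUnion Z) - ∑ l ∈ T, π l ≤ Mk.v i (Z i) - π i := by
  obtain ⟨Z, π, e, y, he, hy, hC⟩ := cmr_limit (Z := Fin n → Finset (Fin m)) (ι := Fin n)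
    (∑ l, Mk.v l Finset.univ + 1)
    (fun Z ε π => CmrSt Mk ε Z π ∧ ∑ l, π0 l ≤ ∑ l, π l ∧ ∀ i, ∀ T : Finset (Fin n),
      Mk.v i (T.biUnion Z) - ∑ l ∈ T, π l ≤ Mk.v i (Z i) - π i + ε) (by
    intro ε hε hε1
    obtain ⟨Z, π, h1, h2⟩ := cmr_merge_eps Mk ε hε hε1 Z0 π0 h0
    refine ⟨Z, π, fun i => ?_, h1, h2⟩
    rw [abs_of_nonneg (h1.2.2.1 i)]
    exact cmr_st_bound Mk ε hε1 Z π h1 i)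
  have hsum : ∀ (U : Finset (Fin n)), Filter.Tendsto (fun k => ∑ j ∈ U, y k j)
      Filter.atTop (nhds (∑ j ∈ U, π j)) := fun U =>
    tendsto_finsetSum _ (fun j _ => hy j)
  have hall : ∀ i, ∀ T : Finset (Fin n),
      Mk.v i (T.biUnion Z) - ∑ l ∈ T, π l ≤ Mk.v i (Z i) - π i := by
    intro i T
    have := le_of_tendsto_of_tendsto' (tendsto_const_nhds.sub (hsum T))
      ((tendsto_const_nhds.sub (hy i)).add he) (fun k => (hC k).2.2.2 i T)
    linarith
  refine ⟨Z, π, ⟨(hC 0).2.1.1, (hC 0).2.1.2.1, ?_, ?_, ?_⟩, ?_, hall⟩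
  · exact fun i => ge_of_tendsto' (hy i) (fun k => (hC k).2.1.2.2.1 i)
  · intro i hi
    refine tendsto_nhds_unique (hy i) ?_
    have : (fun k => y k i) = fun _ => 0 := funext fun k => (hC k).2.1.2.2.2.1 i hi
    rw [this]
    exact tendsto_const_nhds
  · intro i _ T
    linarith [hall i T]
  · exact ge_of_tendsto' (hsum Finset.univ) (fun k => (hC k).2.2.1)

lemma cmr_cbe {n m : ℕ} (hn : 1 ≤ n) (Mk : Market n m)
    (Z : Fin n → Finset (Fin m)) (π : Fin n → ℝ) (h : CmrSt Mk 0 Z π)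
    (hall : ∀ i, ∀ T : Finset (Fin n),
      Mk.v i (T.biUnion Z) - ∑ l ∈ T, π l ≤ Mk.v i (Z i) - π i) :
    ∃ E : CBE Mk, E.revenue = ∑ l, π l := by
  classical
  obtain ⟨hal, hcov, hpos, hemp, -⟩ := h
  have hinj : ∀ a b, Z a = Z b → (Z a).Nonempty → a = b := by
    intro a b hab hne
    by_contra hc
    have := hal a b hc
    rw [← hab, disjoint_self] at this
    exact hne.ne_empty this
  let bs : Finset (Finset (Fin m)) := (Finset.univ.image Z).filter fun b => b.Nonempty
  have hbs : ∀ b, b ∈ bs ↔ (∃ i, Z i = b) ∧ b.Nonempty := by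
    intro b; simp [bs]
  let asg : Finset (Fin m) → Fin n := fun b => if hb : ∃ i, Z i = b then hb.choose else ⟨0, hn⟩
  have hasg : ∀ i, (Z i).Nonempty → asg (Z i) = i := by
    intro i hi
    have hb : ∃ l, Z l = Z i := ⟨i, rfl⟩
    have h1 : asg (Z i) = hb.choose := dif_pos hb
    rw [h1]
    exact (hinj i _ hb.choose_spec.symm hi).symm
  let pr : Finset (Fin m) → ℝ := fun b => π (asg b)
  have hasg' : ∀ b ∈ bs, Z (asg b) = b := by
    intro b hb
    obtain ⟨⟨i, rfl⟩, hne⟩ := (hbs b).1 hb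
    rw [hasg i hne]
  have hsumT : ∀ T : Finset (Finset (Fin m)), T ⊆ bs → ∑ b ∈ T, pr b = ∑ l ∈ T.image asg, π l := by
    intro T hT
    rw [Finset.sum_image]
    intro a ha b hb hab
    rw [← hasg' a (hT ha), ← hasg' b (hT hb), hab]
  have hbiT : ∀ T : Finset (Finset (Fin m)), T ⊆ bs → T.biUnion id = (T.image asg).biUnion Z := by
    intro T hT
    rw [Finset.image_biUnion]
    exact Finset.biUnion_congr rfl fun b hb => (hasg' b (hT hb)).symm
  have himg : ∀ i, (Z i).Nonempty → (bs.filter fun b => asg b = i) = {Z i} := by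
    intro i hi
    ext b
    simp only [Finset.mem_filter, Finset.mem_singleton]
    constructor
    · rintro ⟨hb, rfl⟩
      exact (hasg' b hb).symm
    · rintro rfl
      exact ⟨(hbs _).2 ⟨⟨i, rfl⟩, hi⟩, hasg i hi⟩
  have himg0 : ∀ i, ¬ (Z i).Nonempty → (bs.filter fun b => asg b = i) = ∅ := by
    intro i hi
    rw [Finset.filter_eq_empty_iff]
    rintro b hb rfl
    rw [hasg' b hb] at hi
    exact hi ((hbs b).1 hb).2
  refine ⟨⟨bs, pr, asg, fun b hb => ((hbs b).1 hb).2, ?_, ?_, fun b _ => hpos _, ?_⟩, ?_⟩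
  · intro b hb b' hb' hne
    obtain ⟨⟨i, rfl⟩, -⟩ := (hbs b).1 hb
    obtain ⟨⟨l, rfl⟩, -⟩ := (hbs b').1 hb'
    exact hal i l (fun h => hne (h ▸ rfl))
  · ext e
    simp only [Finset.mem_biUnion, Finset.mem_univ, iff_true, id]
    obtain ⟨i, hi⟩ := hcov e
    exact ⟨Z i, (hbs _).2 ⟨⟨i, rfl⟩, ⟨e, hi⟩⟩, hi⟩
  · intro i T hT
    rw [hsumT T hT, hbiT T hT]
    refine le_trans (hall i _) ?_
    by_cases hi : (Z i).Nonempty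
    · rw [himg i hi]
      simp [pr, hasg i hi]
    · rw [himg0 i hi]
      rw [Finset.not_nonempty_iff_eq_empty] at hi
      simp [hi, hemp i hi]
  · change ∑ b ∈ bs, pr b = _
    rw [hsumT bs subset_rfl]
    apply Finset.sum_subset (Finset.subset_univ _)
    intro i _ hi
    apply hemp
    by_contra hc
    apply hi
    have hne := Finset.nonempty_iff_ne_empty.2 hc
    exact Finset.mem_image.2 ⟨Z i, (hbs _).2 ⟨⟨i, rfl⟩, hne⟩, hasg i hne⟩

lemma cmr_state {n m : ℕ} (hn : 1 ≤ n) (ℳ : Matroid (Fin m)) (Mk : Market n m)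
    (w : Fin n → Fin m → ℝ)
    (hw : ∀ i, ∀ S : Finset (Fin m), IsGreatest
      {x : ℝ | ∃ U : Finset (Fin m), U ⊆ S ∧ ℳ.Indep (U : Set (Fin m)) ∧ x = ∑ j ∈ U, w i j}
      (Mk.v i S))
    (P : Finset (Fin n)) (hP : P.Nonempty) (p : Fin m → ℝ) (hp : ∀ j, 0 ≤ p j)
    (S : Fin n → Finset (Fin m)) (hS : CmrValid ℳ w 0 P p S)
    (h0 : ∀ e, (∀ i, e ∉ S i) → p e = 0) (c : ℝ) (hc : 0 ≤ c)
    (hu : ∀ i ∈ P, c ≤ ∑ j ∈ S i, (w i j - p j)) :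
    ∃ E : CBE Mk, ∑ j, p j + c * (P.card : ℝ) ≤ E.revenue := by
  classical
  obtain ⟨i0, hi0⟩ := hP
  obtain ⟨hal, hout, hopt⟩ := hS
  let R : Finset (Fin m) := Finset.univ.filter fun e => ∀ i, e ∉ S i
  let Z : Fin n → Finset (Fin m) := fun i => if i = i0 then S i ∪ R else S i
  let q : Fin n → ℝ := fun l => ∑ j ∈ S l, p j
  let π : Fin n → ℝ := fun l => q l + if l ∈ P then c else 0
  have hRd : ∀ i, Disjoint R (S i) := by
    intro i
    rw [Finset.disjoint_left]
    intro x hx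
    exact (Finset.mem_filter.1 hx).2 i
  have hZ0 : Z i0 = S i0 ∪ R := if_pos rfl
  have hZ1 : ∀ i, i ≠ i0 → Z i = S i := fun i hi => if_neg hi
  have hSZ : ∀ i, S i ⊆ Z i := by
    intro i
    by_cases hi : i = i0
    · subst hi
      rw [hZ0]
      exact Finset.subset_union_left
    · rw [hZ1 i hi]
  have hZq : ∀ i, ∑ j ∈ Z i, p j = q i := by
    intro i
    symm
    apply Finset.sum_subset (hSZ i)
    intro x hx hx'
    by_cases hi : i = i0
    · subst hi
      rw [hZ0, Finset.mem_union] at hx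
      rcases hx with hx | hx
      · exact absurd hx hx'
      · exact h0 x (Finset.mem_filter.1 hx).2
    · rw [hZ1 i hi] at hx
      exact absurd hx hx'
  have hZal : IsAllocation Z := by
    intro a b hab
    by_cases ha : a = i0
    · subst ha
      rw [hZ0, hZ1 b hab.symm, Finset.disjoint_union_left]
      exact ⟨hal _ _ hab, hRd b⟩
    · rw [hZ1 a ha]
      by_cases hb : b = i0
      · subst hb
        rw [hZ0, Finset.disjoint_union_right]
        exact ⟨hal _ _ hab, (hRd a).symm⟩
      · rw [hZ1 b hb]
        exact hal a b hab
  have hcov : ∀ e, ∃ i, e ∈ Z i := by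
    intro e
    by_cases h : ∀ i, e ∉ S i
    · refine ⟨i0, ?_⟩
      rw [hZ0]
      exact Finset.mem_union_right _ (Finset.mem_filter.2 ⟨Finset.mem_univ _, h⟩)
    · push Not at h
      obtain ⟨i, hi⟩ := h
      exact ⟨i, hSZ i hi⟩
  have hq : ∀ i, 0 ≤ q i := fun i => Finset.sum_nonneg fun j _ => hp j
  have hsumZ : ∀ T : Finset (Fin n), ∑ j ∈ T.biUnion Z, p j = ∑ l ∈ T, q l := by
    intro T
    rw [Finset.sum_biUnion (fun a _ b _ hab => hZal a b hab)]
    exact Finset.sum_congr rfl fun i _ => hZq i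
  have hext : ∀ l, 0 ≤ (if l ∈ P then c else 0) := by
    intro l
    split_ifs <;> linarith
  have hst : CmrSt Mk 0 Z π := by
    refine ⟨hZal, hcov, fun i => add_nonneg (hq i) (hext i), ?_, ?_⟩
    · intro i hi
      have hSi : S i = ∅ := Finset.subset_empty.1 (hi ▸ hSZ i)
      have hqi : q i = 0 := by simp [q, hSi]
      by_cases hiP : i ∈ P
      · have := hu i hiP
        rw [hSi, Finset.sum_empty] at this
        have : c = 0 := le_antisymm this hc
        simp [π, hqi, this]
      · simp [π, hqi, hiP]
    · intro i hi T
      have hiP : i ∈ P := by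
        by_contra hcon
        apply hi
        rw [hZ1 i (fun h => hcon (h ▸ hi0)), hout i hcon]
      have hui := hu i hiP
      have hval : ∑ j ∈ S i, w i j ≤ Mk.v i (Z i) :=
        (hw i (Z i)).2 ⟨S i, hSZ i, (hopt i hiP).1, rfl⟩
      have hsp : ∑ j ∈ S i, (w i j - p j) = ∑ j ∈ S i, w i j - q i := Finset.sum_sub_distrib _ _
      have hπi : π i = q i + c := by simp [π, hiP]
      have hπT : ∑ l ∈ T, π l = ∑ l ∈ T, q l + ∑ l ∈ T, (if l ∈ P then c else 0) :=
        Finset.sum_add_distrib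
      by_cases hT : ∃ l ∈ T, l ∈ P
      · obtain ⟨l, hlT, hlP⟩ := hT
        obtain ⟨U, hUsub, hUi, hUv⟩ := (hw i (T.biUnion Z)).1
        have h1 := (hopt i hiP).2 U hUi
        rw [Finset.sum_sub_distrib, zero_mul, sub_zero] at h1
        have h2 : ∑ j ∈ U, p j ≤ ∑ j ∈ T.biUnion Z, p j :=
          Finset.sum_le_sum_of_subset_of_nonneg hUsub (fun j _ _ => hp j)
        rw [hsumZ] at h2
        have h3 : c ≤ ∑ l ∈ T, (if l ∈ P then c else 0) := by
          have := Finset.single_le_sum (f := fun l => if l ∈ P then c else 0)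
            (fun l _ => hext l) hlT
          simpa [hlP] using this
        rw [hUv, hπT, hπi]
        linarith
      · push Not at hT
        have hne : ∀ l ∈ T, Z l = ∅ := by
          intro l hl
          rw [hZ1 l (fun h => hT l hl (h ▸ hi0)), hout l (hT l hl)]
        have hemp : T.biUnion Z = ∅ := by
          rw [Finset.eq_empty_iff_forall_notMem]
          intro x hx
          obtain ⟨l, hl, hx⟩ := Finset.mem_biUnion.1 hx
          simp [hne l hl] at hx
        have h3 : 0 ≤ ∑ l ∈ T, π l := Finset.sum_nonneg fun l _ => add_nonneg (hq l) (hext l)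
        rw [hemp, Mk.v_empty, hπi]
        linarith
  obtain ⟨Z', π', h1, h2, h3⟩ := cmr_merge Mk Z π hst
  obtain ⟨E, hE⟩ := cmr_cbe hn Mk Z' π' h1 h3
  refine ⟨E, ?_⟩
  rw [hE]
  refine le_trans (le_of_eq ?_) h2
  have hun : (Finset.univ : Finset (Fin n)).biUnion Z = Finset.univ := by
    ext e
    simpa using hcov e
  have h4 := hsumZ Finset.univ
  rw [hun] at h4
  have h5 : ∑ l, π l = ∑ l, q l + ∑ l, (if l ∈ P then c else 0) := Finset.sum_add_distrib
  rw [h5, h4]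
  simp [mul_comm]

lemma cmr_harmonic {n : ℕ} (u : Fin n → ℝ) (hu : ∀ i, 0 ≤ u i) (X : ℝ) (k : ℕ) :
    ∀ Q : Finset (Fin n), Q.card = k →
      (∀ i ∈ Q, u i * ((Q.filter fun l => u i ≤ u l).card : ℝ) ≤ X) →
      ∑ i ∈ Q, u i ≤ X * (harmonic k : ℝ) := by
  induction k with
  | zero =>
    intro Q hQ _
    rw [Finset.card_eq_zero] at hQ
    simp [hQ]
  | succ k ih =>
    intro Q hQ h
    have hne : Q.Nonempty := Finset.card_pos.1 (by omega)
    obtain ⟨i, hi, hmin⟩ := Finset.exists_min_image Q u hne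
    have h1 := h i hi
    rw [Finset.filter_true_of_mem hmin, hQ] at h1
    have h2 := ih (Q.erase i) (by rw [Finset.card_erase_of_mem hi, hQ]; rfl) (by
      intro l hl
      refine le_trans ?_ (h l (Finset.mem_of_mem_erase hl))
      apply mul_le_mul_of_nonneg_left _ (hu l)
      have := Finset.card_le_card
        (Finset.filter_subset_filter (fun a => u l ≤ u a) (Finset.erase_subset i Q))
      exact_mod_cast this)
    rw [← Finset.add_sum_erase Q u hi, harmonic_succ]
    push_cast at h1 ⊢
    have hk : (0 : ℝ) < (k : ℝ) + 1 := by positivity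
    have h3 : u i ≤ X * ((k : ℝ) + 1)⁻¹ := by
      rw [← div_eq_mul_inv, le_div_iff₀ hk]
      exact h1
    rw [mul_add]
    linarith

lemma cmr_log (k μ : ℕ) (hk : k ≤ μ) (hμ : 1 ≤ μ) :
    (harmonic k : ℝ) ≤ 1 + Real.logb 2 (μ : ℝ) := by
  have h1 := harmonic_le_one_add_log k
  have hμ' : (1 : ℝ) ≤ (μ : ℝ) := by exact_mod_cast hμ
  have h0 : 0 ≤ Real.log (μ : ℝ) := Real.log_nonneg hμ'
  have h2 : Real.log (k : ℝ) ≤ Real.log (μ : ℝ) := by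
    rcases Nat.eq_zero_or_pos k with rfl | hpos
    · simpa using h0
    · exact Real.log_le_log (by exact_mod_cast hpos) (by exact_mod_cast hk)
  have h3 : Real.log (μ : ℝ) ≤ Real.logb 2 (μ : ℝ) := by
    rw [Real.logb, le_div_iff₀ (Real.log_pos (by norm_num))]
    have := Real.log_two_lt_d9
    nlinarith
  linarith

/-- There is an absolute constant `c > 0` such that for every matroid `ℳ`
on the ground set of items, every market in which each valuation is a weighted rank
function of `ℳ` admits a CBE with revenue at least `c * OPT / (log₂ μ + 2)`. -/
theorem common_matroid_revenue :
    ∃ c : ℝ, 0 < c ∧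
      ∀ (n m : ℕ), 1 ≤ n → 1 ≤ m → ∀ (ℳ : Matroid (Fin m)), ℳ.E = Set.univ →
        ∀ (Mk : Market n m),
        (∀ i : Fin n, ∃ w : Fin m → ℝ, (∀ j, 0 ≤ w j) ∧
          ∀ S : Finset (Fin m),
            IsGreatest
              {x : ℝ | ∃ U : Finset (Fin m), U ⊆ S ∧ ℳ.Indep ↑U ∧ x = ∑ j ∈ U, w j}
              (Mk.v i S)) →
        ∃ E : CBE Mk, E.revenue ≥ c * OPT Mk / (Real.logb 2 (min n m : ℕ) + 2) := by
  refine ⟨1 / 2, by norm_num, ?_⟩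
  intro n m hn hm ℳ hE Mk hwr
  classical
  choose w hw0 hw using hwr
  have hind : ℳ.Indep ((∅ : Finset (Fin m)) : Set (Fin m)) := by simp
  have hstart : CmrValid ℳ w 0 Finset.univ (fun j => ∑ i, w i j) (fun _ => ∅) := by
    refine ⟨fun _ _ _ => by simp, fun _ _ => rfl, fun i _ => ⟨hind, fun U _ => ?_⟩⟩
    rw [zero_mul, sub_zero, Finset.sum_empty]
    apply Finset.sum_nonpos
    intro j _
    have := Finset.single_le_sum (f := fun i => w i j) (fun i _ => hw0 i j) (Finset.mem_univ i)
    linarith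
  obtain ⟨S, p, hp, hval, hun⟩ := cmr_we ℳ hE w Finset.univ _
    (fun j => Finset.sum_nonneg fun i _ => hw0 i j) _ hstart
  set u : Fin n → ℝ := fun i => ∑ j ∈ S i, (w i j - p j) with hu
  have hu0 : ∀ i, 0 ≤ u i := by
    intro i
    have := (hval.2.2 i (Finset.mem_univ i)).2 ∅ hind
    rwa [Finset.sum_empty, zero_mul, sub_zero] at this
  have hOPT : OPT Mk ≤ ∑ i, u i + ∑ j, p j := by
    refine csSup_le (s := {w : ℝ | ∃ S : Fin n → Finset (Fin m), IsAllocation S ∧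
      allocWelfare Mk S = w}) ⟨_, fun _ => ∅, fun _ _ _ => by simp, rfl⟩ ?_
    rintro x ⟨A, hA, rfl⟩
    have h1 : ∀ i ∈ Finset.univ, Mk.v i (A i) ≤ u i + ∑ j ∈ A i, p j := by
      intro i hi
      obtain ⟨U, hUs, hUi, hUv⟩ := (hw i (A i)).1
      have h2 := (hval.2.2 i hi).2 U hUi
      rw [Finset.sum_sub_distrib, zero_mul, sub_zero] at h2
      have h3 : ∑ j ∈ U, p j ≤ ∑ j ∈ A i, p j :=
        Finset.sum_le_sum_of_subset_of_nonneg hUs (fun j _ _ => (hp j).1)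
      rw [hUv]
      simp only [hu]
      linarith
    refine (Finset.sum_le_sum h1).trans ?_
    rw [Finset.sum_add_distrib, ← Finset.sum_biUnion (fun a _ b _ hab => hA a b hab)]
    have := Finset.sum_le_sum_of_subset_of_nonneg
      (Finset.subset_univ (Finset.univ.biUnion A)) (fun j _ _ => (hp j).1)
    linarith
  by_contra hcon
  push Not at hcon
  set μ : ℕ := min n m with hμ
  have hμ1 : 1 ≤ μ := le_min hn hm
  set L : ℝ := Real.logb 2 (μ : ℝ) + 2 with hL
  have hlog0 : 0 ≤ Real.logb 2 (μ : ℝ) :=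
    Real.logb_nonneg (by norm_num) (by exact_mod_cast hμ1)
  set X : ℝ := 1 / 2 * OPT Mk / L with hX
  have hLpos : 0 < L := by linarith
  have hXL : X * L = 1 / 2 * OPT Mk := by
    rw [hX]
    field_simp
  -- revenue of the Walrasian equilibrium itself
  have hpX : ∑ j, p j < X := by
    obtain ⟨E, hrev⟩ := cmr_state hn ℳ Mk w hw Finset.univ ⟨⟨0, hn⟩, Finset.mem_univ _⟩ p
      (fun j => (hp j).1) S hval hun 0 le_rfl (fun i _ => hu0 i)
    have := hcon E
    linarith
  have hp0 : 0 ≤ ∑ j, p j := Finset.sum_nonneg fun j _ => (hp j).1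
  have hXpos : 0 < X := by linarith
  have hui : ∀ i, u i * ((Finset.univ.filter fun l => u i ≤ u l).card : ℝ) ≤ X := by
    intro i
    set P : Finset (Fin n) := Finset.univ.filter fun l => u i ≤ u l with hP
    have hiP : i ∈ P := by simp [hP]
    have hvP : CmrValid ℳ w 0 P p (fun l => if l ∈ P then S l else ∅) := by
      refine ⟨?_, ?_, ?_⟩
      · intro a b hab
        simp only
        split_ifs
        · exact hval.1 a b hab
        all_goals simp
      · intro l hl
        exact if_neg hl
      · intro l hl
        simp only [if_pos hl]
        exact hval.2.2 l (Finset.mem_univ l)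
    obtain ⟨S', p', hp', hval', hun'⟩ := cmr_we ℳ hE w P p (fun j => (hp j).1) _ hvP
    obtain ⟨E, hrev⟩ := cmr_state hn ℳ Mk w hw P ⟨i, hiP⟩ p'
      (fun j => (hp' j).1) S' hval' hun' (u i) (hu0 i) (by
        intro l hl
        have h1 := (hval'.2.2 l hl).2 (S l) (hval.2.2 l (Finset.mem_univ l)).1
        rw [zero_mul, sub_zero] at h1
        have h2 : u l ≤ ∑ j ∈ S l, (w l j - p' j) :=
          Finset.sum_le_sum fun j _ => by linarith [(hp' j).2]
        have h3 : u i ≤ u l := (Finset.mem_filter.1 hl).2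
        linarith)
    have h1 := hcon E
    have h2 : 0 ≤ ∑ j, p' j := Finset.sum_nonneg fun j _ => (hp' j).1
    linarith
  let Q : Finset (Fin n) := Finset.univ.filter fun i => 0 < u i
  have hQsum : ∑ i, u i = ∑ i ∈ Q, u i := by
    symm
    apply Finset.sum_subset (Finset.subset_univ _)
    intro i _ hi
    have : ¬ 0 < u i := fun h => hi (Finset.mem_filter.2 ⟨Finset.mem_univ _, h⟩)
    linarith [hu0 i]
  have hQn : Q.card ≤ n := by
    simpa using Finset.card_le_univ Q
  have hQm : Q.card ≤ m := by
    have hne : ∀ i ∈ Q, (S i).Nonempty := by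
      intro i hi
      by_contra hc
      rw [Finset.not_nonempty_iff_eq_empty] at hc
      have := (Finset.mem_filter.1 hi).2
      simp [hu, hc] at this
    have h1 : Q.card ≤ (Q.biUnion S).card := by
      rw [Finset.card_biUnion (fun a _ b _ hab => hval.1 a b hab), Finset.card_eq_sum_ones]
      exact Finset.sum_le_sum fun i hi => Finset.card_pos.2 (hne i hi)
    exact h1.trans (by simpa using Finset.card_le_univ (Q.biUnion S))
  have hQh := cmr_harmonic u hu0 X Q.card Q rfl (by
    intro i _
    refine le_trans ?_ (hui i)
    apply mul_le_mul_of_nonneg_left _ (hu0 i)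
    have := Finset.card_le_card
      (Finset.filter_subset_filter (fun a => u i ≤ u a) (Finset.subset_univ Q))
    exact_mod_cast this)
  have hlog := cmr_log Q.card μ (le_min hQn hQm) hμ1
  have h1 := mul_le_mul_of_nonneg_left hlog hXpos.le
  have h2 : X * L = X + X * (1 + Real.logb 2 (μ : ℝ)) := by
    rw [hL]; ring
  have h3 : 0 < X * L := mul_pos hXpos hLpos
  linarith
end

section
/- If a combinatorial market admits a partial competitive bundling equilibrium with respect to some subset N' of the consumers, with bundling 𝓑 and prices p, then the market admits a competitive bundling equilibrium (with respect to all consumers) whose welfare is at least Σ_{B∈𝓑} p_B. -/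
open Finset

/-- A partial competitive bundling equilibrium with respect to a set `N'` of consumers:
a partition of the items into nonempty priced bundles, each assigned to a consumer in
`N'`, such that profit maximization holds for every consumer in `N'`. -/
structure PartialCBE {n m : ℕ} (Mk : Market n m) (N' : Set (Fin n)) where
  bundles : Finset (Finset (Fin m))
  price : Finset (Fin m) → ℝ
  assign : Finset (Fin m) → Fin n
  bundles_nonempty : ∀ b ∈ bundles, b.Nonempty
  bundles_disjoint : ∀ b ∈ bundles, ∀ b' ∈ bundles, b ≠ b' → Disjoint b b'
  bundles_cover : bundles.biUnion id = Finset.univ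
  price_nonneg : ∀ b ∈ bundles, 0 ≤ price b
  assign_mem : ∀ b ∈ bundles, assign b ∈ N'
  profit_max : ∀ i ∈ N', ∀ T : Finset (Finset (Fin m)), T ⊆ bundles →
    Mk.v i ((bundles.filter fun b => assign b = i).biUnion id)
        - ∑ b ∈ bundles.filter fun b => assign b = i, price b
      ≥ Mk.v i (T.biUnion id) - ∑ b ∈ T, price b

namespace CBEProof

/-- Items held by the consumers in `T` under the item assignment `a`. -/
def held {n m : ℕ} (a : Fin m → Fin n) (T : Finset (Fin n)) : Finset (Fin m) :=
  Finset.univ.filter fun x => a x ∈ T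

/-- Consumer `i` is `ε`-satisfied. -/
def Sat {n m : ℕ} (Mk : Market n m) (ε : ℝ) (a : Fin m → Fin n) (q : Fin n → ℝ)
    (i : Fin n) : Prop :=
  ∀ T : Finset (Fin n), Mk.v i (held a T) - ∑ j ∈ T, q j ≤ Mk.v i (held a {i}) - q i + ε

/-- Approximate partial state: all consumers holding something are `ε`-satisfied. -/
structure PState {n m : ℕ} (Mk : Market n m) (R ε : ℝ) (a : Fin m → Fin n)
    (q : Fin n → ℝ) : Prop where
  nonneg : ∀ j, 0 ≤ q j
  zero : ∀ j, (∀ x, a x ≠ j) → q j = 0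
  sat : ∀ x, Sat Mk ε a q (a x)
  rev : R ≤ ∑ j, q j

/-- Approximate full state. -/
structure FState {n m : ℕ} (Mk : Market n m) (R ε : ℝ) (a : Fin m → Fin n)
    (q : Fin n → ℝ) : Prop where
  nonneg : ∀ j, 0 ≤ q j
  zero : ∀ j, (∀ x, a x ≠ j) → q j = 0
  sat : ∀ i, Sat Mk ε a q i
  rev : R ≤ ∑ j, q j

variable {n m : ℕ} {Mk : Market n m}

lemma v_nonneg (Mk : Market n m) (i : Fin n) (S) : 0 ≤ Mk.v i S := by
  rw [← Mk.v_empty i]; exact Mk.v_mono i _ _ (by simp)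

lemma Sat.bound {ε a q i} (h : Sat Mk ε a q i) : q i ≤ Mk.v i univ + ε := by
  have := h ∅
  have h2 := Mk.v_mono i (held a {i}) univ (by simp)
  have h3 := v_nonneg Mk i (held a ∅)
  simp only [Finset.sum_empty] at this
  linarith

lemma PState.bound {R ε a q} (hε : 0 ≤ ε) (h : PState Mk R ε a q) (i : Fin n) :
    q i ≤ Mk.v i univ + ε := by
  by_cases hx : ∃ x, a x = i
  · obtain ⟨x, rfl⟩ := hx
    exact (h.sat x).bound
  · push Not at hx
    rw [h.zero i hx]
    have := v_nonneg Mk i univ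
    linarith

lemma step {R ε a q} (hε : 0 < ε) (h : PState Mk R ε a q) (i : Fin n)
    (hi : ¬ Sat Mk ε a q i) : ∃ a' q', PState Mk (∑ j, q j + ε) ε a' q' := by
  have hix : ∀ x, a x ≠ i := fun x hx => hi (hx ▸ h.sat x)
  have qi := h.zero i hix
  obtain ⟨T, -, hT⟩ := Finset.exists_max_image (univ : Finset (Finset (Fin n)))
    (fun T => Mk.v i (held a T) - ∑ j ∈ T, q j) ⟨∅, by simp⟩
  have hpos : 0 < Mk.v i (held a T) - ∑ j ∈ T, q j := by
    unfold Sat at hi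
    push Not at hi
    obtain ⟨T0, h0⟩ := hi
    have := hT T0 (by simp)
    have := v_nonneg Mk i (held a {i})
    linarith
  let a' : Fin m → Fin n := fun x => if a x ∈ T then i else a x
  let q' : Fin n → ℝ := fun j => if j = i then ∑ j ∈ T, q j + ε else if j ∈ T then 0 else q j
  have q'nn : ∀ j, 0 ≤ q' j := by
    intro j
    have := Finset.sum_nonneg (s := T) (fun j _ => h.nonneg j)
    have := h.nonneg j
    simp only [q']; split_ifs <;> linarith
  -- sums of the new prices
  have hsum : ∀ T' : Finset (Fin n), i ∉ T' → ∑ j ∈ T', q' j = ∑ j ∈ T' \ T, q j := by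
    intro T' hiT
    rw [Finset.sdiff_eq_filter, Finset.sum_filter]
    refine Finset.sum_congr rfl fun j hj => ?_
    have : j ≠ i := fun e => hiT (e ▸ hj)
    simp only [q', this, if_false]
    split_ifs <;> simp_all
  have hsum2 : ∀ T' : Finset (Fin n), i ∈ T' →
      ∑ j ∈ T', q' j = ∑ j ∈ T' ∪ T, q j + ε := by
    intro T' hiT
    rw [← Finset.add_sum_erase _ _ hiT, hsum _ (by simp)]
    have e1 : ∑ j ∈ T'.erase i \ T, q j = ∑ j ∈ T' \ T, q j := by
      refine Finset.sum_subset (by intro j; simp; tauto) ?_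
      intro j h1 h2
      have : j = i := by
        by_contra hne
        simp_all
      rw [this, qi]
    rw [e1, ← Finset.sdiff_union_self_eq_union, Finset.sum_union Finset.sdiff_disjoint]
    simp only [q', if_true]; ring
  have hopt : ∀ T' : Finset (Fin n), ∃ T0 : Finset (Fin n),
      held a' T' = held a T0 ∧ ∑ j ∈ T0, q j ≤ ∑ j ∈ T', q' j := by
    intro T'
    by_cases hiT : i ∈ T'
    · refine ⟨T' ∪ T, ?_, by rw [hsum2 _ hiT]; linarith⟩
      ext x
      simp only [held, a', Finset.mem_filter, Finset.mem_univ, true_and, Finset.mem_union]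
      split_ifs <;> simp_all
    · refine ⟨T' \ T, ?_, by rw [hsum _ hiT]⟩
      ext x
      simp only [held, a', Finset.mem_filter, Finset.mem_univ, true_and, Finset.mem_sdiff]
      split_ifs <;> simp_all
  refine ⟨a', q', q'nn, ?_, ?_, ?_⟩
  · intro j hj
    by_cases hji : j = i
    · exfalso
      subst hji
      have : held a T = ∅ := by
        ext x
        have := hj x
        simp only [held, a', Finset.mem_filter] at *
        split_ifs at this <;> simp_all
      rw [this, Mk.v_empty] at hpos
      have := Finset.sum_nonneg (s := T) (fun j _ => h.nonneg j)
      linarith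
    · simp only [q', hji, if_false]
      split_ifs with hjT
      · rfl
      · apply h.zero
        intro x hx
        apply hj x
        simp [a', hx, hjT]
  · intro x
    by_cases hx : a x ∈ T
    · have e : a' x = i := by simp [a', hx]
      rw [e]
      intro T'
      obtain ⟨T0, h1, h2⟩ := hopt T'
      have h3 := hT T0 (by simp)
      have e2 : held a' {i} = held a T := by
        ext y
        have := hix y
        simp only [held, a', Finset.mem_filter, Finset.mem_univ, true_and, Finset.mem_singleton]
        split_ifs <;> simp_all
      rw [h1, e2]
      simp only [q', if_true] at *
      linarith
    · have e : a' x = a x := by simp [a', hx]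
      rw [e]
      intro T'
      obtain ⟨T0, h1, h2⟩ := hopt T'
      have h3 := h.sat x T0
      have e2 : held a' {a x} = held a {a x} := by
        ext y
        have := hix x
        simp only [held, a', Finset.mem_filter, Finset.mem_univ, true_and, Finset.mem_singleton]
        split_ifs with hy
        · constructor
          · intro h; exact absurd h.symm this
          · intro h; exact absurd (h ▸ hy) hx
        · rfl
      have e3 : q' (a x) = q (a x) := by simp [q', hx, hix x]
      rw [h1, e2, e3]
      linarith
  · rw [hsum2 univ (by simp), Finset.union_eq_left.2 (Finset.subset_univ T)]

lemma PState.mono {R R' ε a q} (h : PState Mk R ε a q) (hR : R' ≤ R) : PState Mk R' ε a q :=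
  ⟨h.nonneg, h.zero, h.sat, hR.trans h.rev⟩

lemma exists_full {R ε a q} (hε : 0 < ε) (h : PState Mk R ε a q) :
    ∃ a q, FState Mk R ε a q := by
  by_contra hno
  have key : ∀ k : ℕ, ∃ a q, PState Mk (R + k * ε) ε a q := by
    intro k
    induction k with
    | zero => exact ⟨a, q, by simpa using h⟩
    | succ k ih =>
      obtain ⟨a, q, hs⟩ := ih
      have : ∃ i, ¬ Sat Mk ε a q i := by
        by_contra hall
        push Not at hall
        exact hno ⟨a, q, hs.nonneg, hs.zero, hall, le_trans (by
          have : 0 ≤ (k : ℝ) * ε := by positivity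
          linarith) hs.rev⟩
      obtain ⟨i, hi⟩ := this
      obtain ⟨a', q', h'⟩ := step hε hs i hi
      refine ⟨a', q', h'.mono ?_⟩
      have := hs.rev
      push_cast
      linarith
  obtain ⟨k, hk⟩ := exists_nat_gt ((∑ i, (Mk.v i univ + ε) - R) / ε)
  obtain ⟨a, q, hs⟩ := key k
  rw [div_lt_iff₀ hε] at hk
  have := Finset.sum_le_sum (s := univ) fun i _ => hs.bound hε.le i
  have := hs.rev
  linarith

lemma FState.mono {R ε ε' a q} (h : FState Mk R ε a q) (hR : ε ≤ ε') : FState Mk R ε' a q :=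
  ⟨h.nonneg, h.zero, fun i T => (h.sat i T).trans (by linarith), h.rev⟩

lemma isClosed_full (R ε : ℝ) (a : Fin m → Fin n) : IsClosed {q | FState Mk R ε a q} := by
  have : {q | FState Mk R ε a q} = {q | (∀ j, 0 ≤ q j) ∧ (∀ j, (∀ x, a x ≠ j) → q j = 0) ∧
      (∀ i, ∀ T : Finset (Fin n),
        Mk.v i (held a T) - ∑ j ∈ T, q j ≤ Mk.v i (held a {i}) - q i + ε) ∧
      R ≤ ∑ j, q j} := by
    ext q
    exact ⟨fun h => ⟨h.1, h.2, h.3, h.4⟩, fun h => ⟨h.1, h.2.1, h.2.2.1, h.2.2.2⟩⟩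
  rw [this]
  simp only [Set.ofPred_and, Set.ofPred_forall]
  refine IsClosed.inter ?_ (IsClosed.inter ?_ (IsClosed.inter ?_ ?_))
  · exact isClosed_iInter fun j => isClosed_le (by fun_prop) (by fun_prop)
  · exact isClosed_iInter fun j => isClosed_iInter fun _ => isClosed_eq (by fun_prop) (by fun_prop)
  · exact isClosed_iInter fun j => isClosed_iInter fun _ => isClosed_le (by fun_prop) (by fun_prop)
  · exact isClosed_le (by fun_prop) (by fun_prop)

lemma exists_exact {R : ℝ} (h : ∀ ε > 0, ∃ a q, FState Mk R ε a q) :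
    ∃ a q, FState Mk R 0 a q := by
  -- a single assignment works for all ε
  have h1 : ∃ a : Fin m → Fin n, ∀ k : ℕ, ∃ q, FState Mk R (1 / ((k : ℝ) + 1)) a q := by
    by_contra hno
    push Not at hno
    choose K hK using hno
    let k := Finset.univ.sup K
    obtain ⟨a, q, hq⟩ := h (1 / ((k : ℝ) + 1)) (by positivity)
    refine hK a q (hq.mono ?_)
    have : K a ≤ k := Finset.le_sup (Finset.mem_univ a)
    exact one_div_le_one_div_of_le (by positivity) (by exact_mod_cast Nat.succ_le_succ this)
  obtain ⟨a, ha⟩ := h1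
  have hne := IsCompact.nonempty_iInter_of_sequence_nonempty_isCompact_isClosed
    (fun k : ℕ => {q | FState Mk R (1 / ((k : ℝ) + 1)) a q})
    (fun k q hq => FState.mono hq (one_div_le_one_div_of_le (by positivity) (by push_cast; linarith)))
    ha
    (by
      refine (isCompact_Icc (a := (0 : Fin n → ℝ))
        (b := fun i => Mk.v i univ + 1)).of_isClosed_subset (isClosed_full _ _ _) ?_
      intro q hq
      refine ⟨fun i => hq.nonneg i, fun i => ?_⟩
      have := (hq.sat i).bound
      simpa using this)
    (fun k => isClosed_full _ _ _)
  obtain ⟨q, hq⟩ := hne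
  rw [Set.mem_iInter] at hq
  refine ⟨a, q, (hq 0).nonneg, (hq 0).zero, fun i T => ?_, (hq 0).rev⟩
  refine le_of_forall_pos_le_add fun ε hε => ?_
  obtain ⟨k, hk⟩ := exists_nat_one_div_lt hε
  have := (hq k).sat i T
  linarith

lemma of_exact (hn : 1 ≤ n) {R a q} (h : FState Mk R 0 a q) : ∃ E : CBE Mk, E.welfare ≥ R := by
  classical
  let B : Finset (Finset (Fin m)) := univ.image fun x => held a {a x}
  let asg : Finset (Fin m) → Fin n := fun b => if hb : b.Nonempty then a hb.choose else ⟨0, hn⟩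
  have hasg : ∀ x, asg (held a {a x}) = a x := by
    intro x
    have hb : (held a {a x}).Nonempty := ⟨x, by simp [held]⟩
    have h2 := Finset.mem_singleton.1 (Finset.mem_filter.1 hb.choose_spec).2
    simp only [asg, hb, dif_pos]
    exact h2
  have hB : ∀ b ∈ B, b = held a {asg b} := by
    intro b hb
    obtain ⟨x, -, rfl⟩ := Finset.mem_image.1 hb
    simp only [hasg]
  have hinj : ∀ T ⊆ B, Set.InjOn asg (T : Set (Finset (Fin m))) := by
    intro T hT b hb c hc e
    rw [hB b (hT hb), hB c (hT hc), e]
  have hun : ∀ T ⊆ B, T.biUnion id = held a (T.image asg) := by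
    intro T hT
    ext x
    simp only [Finset.mem_biUnion, held, Finset.mem_filter, Finset.mem_univ, true_and,
      Finset.mem_image, id]
    refine exists_congr fun b => and_congr_right fun hb => ?_
    rw [hB b (hT hb), ← hB b (hT hb)]
    conv_lhs => rw [hB b (hT hb)]
    simp [held, eq_comm]
  have hself : ∀ i, (B.filter fun b => asg b = i).biUnion id = held a {i} := by
    intro i
    ext x
    simp only [Finset.mem_biUnion, Finset.mem_filter, id]
    constructor
    · rintro ⟨b, ⟨hb, rfl⟩, hx⟩
      rwa [← hB b hb]
    · intro hx
      have : a x = i := by simpa [held] using hx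
      subst this
      exact ⟨_, ⟨Finset.mem_image_of_mem _ (Finset.mem_univ x), hasg x⟩, hx⟩
  have hselfp : ∀ i, ∑ b ∈ B.filter (fun b => asg b = i), q (asg b) = q i := by
    intro i
    by_cases hx : ∃ x, a x = i
    · obtain ⟨x, rfl⟩ := hx
      have : B.filter (fun b => asg b = a x) = {held a {a x}} := by
        ext b
        simp only [Finset.mem_filter, Finset.mem_singleton]
        constructor
        · rintro ⟨hb, e⟩
          rw [← e]; exact hB b hb
        · rintro rfl
          exact ⟨Finset.mem_image_of_mem _ (Finset.mem_univ x), hasg x⟩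
      rw [this, Finset.sum_singleton, hasg]
    · push Not at hx
      rw [h.zero i hx]
      refine Finset.sum_eq_zero fun b hb => ?_
      rw [(Finset.mem_filter.1 hb).2, h.zero i hx]
  refine ⟨⟨B, fun b => q (asg b), asg, ?_, ?_, ?_, fun b _ => h.nonneg _, ?_⟩, ?_⟩
  · intro b hb
    obtain ⟨x, -, rfl⟩ := Finset.mem_image.1 hb
    exact ⟨x, by simp [held]⟩
  · intro b hb c hc hbc
    rw [Finset.disjoint_left]
    intro x h1 h2
    apply hbc
    rw [hB b hb] at h1
    rw [hB c hc] at h2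
    simp only [held, Finset.mem_filter, Finset.mem_singleton, Finset.mem_univ, true_and] at h1 h2
    rw [hB b hb, hB c hc, ← h1, ← h2]
  · ext x
    simp only [Finset.mem_biUnion, Finset.mem_univ, iff_true]
    exact ⟨_, Finset.mem_image_of_mem _ (Finset.mem_univ x), by simp [held]⟩
  · intro i T hT
    rw [hself, hselfp, hun T hT]
    have := h.sat i (T.image asg)
    rw [Finset.sum_image (hinj T hT)] at this
    linarith
  · unfold CBE.welfare
    simp only [hself]
    refine h.rev.trans (Finset.sum_le_sum fun i _ => ?_)
    have := h.sat i ∅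
    have := v_nonneg Mk i (held a ∅)
    simp only [Finset.sum_empty] at *
    linarith

lemma of_partial {N'} (P : PartialCBE Mk N') {ε : ℝ} (hε : 0 ≤ ε) :
    ∃ a q, PState Mk (∑ b ∈ P.bundles, P.price b) ε a q := by
  classical
  have hc : ∀ x, ∃ b ∈ P.bundles, x ∈ b := by
    intro x
    have := P.bundles_cover ▸ Finset.mem_univ x
    simpa using this
  choose β hβ hxβ using hc
  have huniq : ∀ b ∈ P.bundles, ∀ x ∈ b, β x = b := by
    intro b hb x hx
    by_contra hne
    exact Finset.disjoint_left.1 (P.bundles_disjoint _ (hβ x) _ hb hne) (hxβ x) hx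
  let a : Fin m → Fin n := fun x => P.assign (β x)
  let q : Fin n → ℝ := fun j => ∑ b ∈ P.bundles.filter (fun b => P.assign b = j), P.price b
  have hun : ∀ T : Finset (Fin n),
      (P.bundles.filter fun b => P.assign b ∈ T).biUnion id = held a T := by
    intro T
    ext x
    simp only [Finset.mem_biUnion, Finset.mem_filter, id, held, Finset.mem_univ, true_and, a]
    constructor
    · rintro ⟨b, ⟨hb, hT⟩, hx⟩
      rwa [huniq b hb x hx]
    · intro hT
      exact ⟨β x, ⟨hβ x, hT⟩, hxβ x⟩
  have hsum : ∀ T : Finset (Fin n),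
      ∑ b ∈ P.bundles.filter (fun b => P.assign b ∈ T), P.price b = ∑ j ∈ T, q j := by
    intro T
    rw [← Finset.sum_fiberwise_of_maps_to (t := T) (g := P.assign)
      (fun b hb => (Finset.mem_filter.1 hb).2)]
    refine Finset.sum_congr rfl fun j hj => ?_
    refine Finset.sum_congr ?_ fun _ _ => rfl
    ext b
    simp only [Finset.mem_filter]
    constructor
    · rintro ⟨⟨h1, _⟩, h2⟩; exact ⟨h1, h2⟩
    · rintro ⟨h1, h2⟩; exact ⟨⟨h1, h2 ▸ hj⟩, h2⟩
  refine ⟨a, q, ?_, ?_, ?_, ?_⟩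
  · intro j
    exact Finset.sum_nonneg fun b hb => P.price_nonneg b (Finset.mem_filter.1 hb).1
  · intro j hj
    have : P.bundles.filter (fun b => P.assign b = j) = ∅ := by
      rw [Finset.filter_eq_empty_iff]
      intro b hb e
      obtain ⟨x, hx⟩ := P.bundles_nonempty b hb
      apply hj x
      simp only [a, huniq b hb x hx, e]
    simp only [q, this, Finset.sum_empty]
  · intro x T
    have := P.profit_max (a x) (P.assign_mem _ (hβ x)) _
      (Finset.filter_subset (fun b => P.assign b ∈ T) P.bundles)
    rw [hun, hsum] at this
    have h2 := hun {a x}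
    simp only [Finset.mem_singleton] at h2
    rw [h2] at this
    have e : q (a x) = ∑ b ∈ P.bundles.filter (fun b => P.assign b = a x), P.price b := rfl
    rw [e]
    linarith
  · have := hsum univ
    simp only [Finset.mem_univ, Finset.filter_true] at this
    exact this.le

end CBEProof

/-- A partial CBE with respect to `N'` can be lifted to a full CBE whose
welfare is at least the aggregate price of the partial CBE. -/
theorem cbe_from_partial (n m : ℕ) (hn : 1 ≤ n) (hm : 1 ≤ m) (Mk : Market n m)
    (N' : Set (Fin n)) (P : PartialCBE Mk N') :
    ∃ E : CBE Mk, E.welfare ≥ ∑ b ∈ P.bundles, P.price b := by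
  obtain ⟨a, q, h⟩ := CBEProof.exists_exact (Mk := Mk) (R := ∑ b ∈ P.bundles, P.price b)
    (fun ε hε => by
      obtain ⟨a, q, h⟩ := CBEProof.of_partial P (le_of_lt hε)
      exact CBEProof.exists_full hε h)
  exact CBEProof.of_exact hn h
end

section
/- If a combinatorial market admits a high-demand priced bundling with bundling 𝓑 and prices p, then it admits a competitive bundling equilibrium whose welfare is at least Σ_{B∈𝓑} p_B. -/
open Finset

/-- State of the ascending process: a bundling, prices and a partial assignment. -/
structure GoodState {n m : ℕ} (Mk : Market n m) (B : Finset (Finset (Fin m)))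
    (p : Finset (Fin m) → ℝ) (e : ℝ) (C : Finset (Finset (Fin m)))
    (q : Finset (Fin m) → ℝ) (a : Finset (Fin m) → Option (Fin n)) : Prop where
  ne : ∀ b ∈ C, b.Nonempty
  disj : ∀ b ∈ C, ∀ b' ∈ C, b ≠ b' → Disjoint b b'
  cover : C.biUnion id = Finset.univ
  nonneg : ∀ b ∈ C, 0 ≤ q b
  card : C.card ≤ B.card
  unalloc : ∀ b ∈ C, a b = none → b ∈ B ∧ q b = p b
  inj : ∀ b ∈ C, ∀ b' ∈ C, ∀ i, a b = some i → a b' = some i → b = b'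
  dem : ∀ b ∈ C, ∀ i, a b = some i → ∀ T, T ⊆ C →
    Mk.v i (T.biUnion id) - ∑ x ∈ T, q x ≤ Mk.v i b - q b + e
  total : ∑ b ∈ B, p b ≤ ∑ b ∈ C, q b

/-- One step: an unassigned consumer takes a most demanded set, merged, at a price raised by `e`. -/
theorem GoodState.step {n m : ℕ} {Mk : Market n m} {B : Finset (Finset (Fin m))}
    {p : Finset (Fin m) → ℝ} {e : ℝ} (he : 0 < e) {C : Finset (Finset (Fin m))}
    {q : Finset (Fin m) → ℝ} {a : Finset (Fin m) → Option (Fin n)}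
    (h : GoodState Mk B p e C q a) (j : Fin n) (hj : ∀ b ∈ C, a b ≠ some j)
    (T : Finset (Finset (Fin m))) (hT : T ⊆ C)
    (hpos : 0 < Mk.v j (T.biUnion id) - ∑ x ∈ T, q x) :
    ∃ C' q' a', GoodState Mk B p e C' q' a' ∧ ∑ b ∈ C', q' b = ∑ b ∈ C, q b + e := by
  classical
  obtain ⟨D, hDm, hDmax⟩ := Finset.exists_max_image C.powerset
    (fun T => Mk.v j (T.biUnion id) - ∑ x ∈ T, q x) ⟨T, by simpa using hT⟩
  have hD : D ⊆ C := by simpa using hDm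
  have hDmax' : ∀ T, T ⊆ C → Mk.v j (T.biUnion id) - ∑ x ∈ T, q x
      ≤ Mk.v j (D.biUnion id) - ∑ x ∈ D, q x := fun T hT => hDmax T (by simpa using hT)
  have hDne : D.Nonempty := by
    rw [Finset.nonempty_iff_ne_empty]
    rintro rfl
    have := hDmax' T hT
    simp [Mk.v_empty] at this hpos
    linarith
  obtain ⟨u, hu⟩ : ∃ u, u = D.biUnion id := ⟨_, rfl⟩
  have hune : u.Nonempty := by
    obtain ⟨d, hd⟩ := hDne
    obtain ⟨x, hx⟩ := h.ne d (hD hd)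
    exact ⟨x, by rw [hu]; exact Finset.mem_biUnion.2 ⟨d, hd, hx⟩⟩
  have hud : ∀ b ∈ C \ D, Disjoint b u := by
    intro b hb
    rw [Finset.mem_sdiff] at hb
    rw [hu, Finset.disjoint_biUnion_right]
    intro d hd
    exact h.disj b hb.1 d (hD hd) (fun hh => hb.2 (hh ▸ hd))
  have hun : u ∉ C \ D := by
    intro hc
    have := hud u hc
    rw [disjoint_self] at this
    exact hune.ne_empty this
  have hne' : ∀ b ∈ C \ D, b ≠ u := fun b hb hh => hun (hh ▸ hb)
  obtain ⟨q', hq'⟩ : ∃ q', q' = Function.update q u (∑ x ∈ D, q x + e) := ⟨_, rfl⟩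
  obtain ⟨a', ha'⟩ : ∃ a', a' = Function.update a u (some j) := ⟨_, rfl⟩
  have hqu : q' u = ∑ x ∈ D, q x + e := by simp [hq']
  have hau : a' u = some j := by simp [ha']
  have hqo : ∀ b ∈ C \ D, q' b = q b := fun b hb => by
    rw [hq', Function.update_of_ne (hne' b hb)]
  have hao : ∀ b ∈ C \ D, a' b = a b := fun b hb => by
    rw [ha', Function.update_of_ne (hne' b hb)]
  have hsum : ∀ S, S ⊆ C \ D → ∑ x ∈ S, q' x = ∑ x ∈ S, q x := fun S hS =>
    Finset.sum_congr rfl fun x hx => hqo x (hS hx)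
  have htot : ∑ b ∈ insert u (C \ D), q' b = ∑ b ∈ C, q b + e := by
    rw [Finset.sum_insert hun, hsum _ subset_rfl, hqu, ← Finset.sum_sdiff hD]
    ring
  have hexp : ∀ S, S ⊆ insert u (C \ D) → ∃ S', S' ⊆ C ∧ S'.biUnion id = S.biUnion id ∧
      ∑ x ∈ S', q x ≤ ∑ x ∈ S, q' x := by
    intro S hS
    by_cases huS : u ∈ S
    · have hS' : S.erase u ⊆ C \ D := by
        intro x hx
        rw [Finset.mem_erase] at hx
        exact (Finset.mem_insert.1 (hS hx.2)).resolve_left hx.1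
      refine ⟨S.erase u ∪ D, Finset.union_subset (hS'.trans Finset.sdiff_subset) hD, ?_, ?_⟩
      · conv_rhs => rw [← Finset.insert_erase huS]
        rw [Finset.union_biUnion, Finset.biUnion_insert, ← hu, Finset.union_comm]
        rfl
      · rw [Finset.sum_union (Finset.disjoint_of_subset_left hS' Finset.sdiff_disjoint),
          ← Finset.add_sum_erase _ _ huS, hqu, hsum _ hS']
        linarith
    · have hS' : S ⊆ C \ D := fun x hx =>
        (Finset.mem_insert.1 (hS hx)).resolve_left (fun hh => huS (hh ▸ hx))
      exact ⟨S, hS'.trans Finset.sdiff_subset, rfl, (hsum S hS').ge⟩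
  refine ⟨insert u (C \ D), q', a', ⟨?_, ?_, ?_, ?_, ?_, ?_, ?_, ?_, ?_⟩, htot⟩
  · intro b hb
    rcases Finset.mem_insert.1 hb with rfl | hb
    · exact hune
    · exact h.ne b (Finset.mem_sdiff.1 hb).1
  · intro b hb b' hb' hbb
    rw [Finset.mem_insert] at hb hb'
    rcases hb with rfl | hb <;> rcases hb' with rfl | hb'
    · exact absurd rfl hbb
    · exact (hud b' hb').symm
    · exact hud b hb
    · exact h.disj b (Finset.mem_sdiff.1 hb).1 b' (Finset.mem_sdiff.1 hb').1 hbb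
  · rw [Finset.biUnion_insert, ← h.cover]
    conv_rhs => rw [← Finset.sdiff_union_of_subset hD]
    rw [Finset.union_biUnion, ← hu, Finset.union_comm]
    rfl
  · intro b hb
    rcases Finset.mem_insert.1 hb with rfl | hb
    · rw [hqu]
      have := Finset.sum_nonneg fun x hx => h.nonneg x (hD hx)
      linarith
    · rw [hqo b hb]
      exact h.nonneg b (Finset.mem_sdiff.1 hb).1
  · have h1 := Finset.card_insert_le u (C \ D)
    have h2 := Finset.card_sdiff_add_card_eq_card hD
    have h3 := hDne.card_pos
    have h4 := h.card
    omega
  · intro b hb hab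
    rcases Finset.mem_insert.1 hb with rfl | hb
    · simp [hau] at hab
    · rw [hao b hb] at hab
      rw [hqo b hb]
      exact h.unalloc b (Finset.mem_sdiff.1 hb).1 hab
  · intro b hb b' hb' i hi hi'
    rw [Finset.mem_insert] at hb hb'
    rcases hb with rfl | hb <;> rcases hb' with rfl | hb'
    · rfl
    · rw [hao b' hb'] at hi'
      rw [hau] at hi
      exact absurd (hi'.trans hi.symm) (hj b' (Finset.mem_sdiff.1 hb').1)
    · rw [hao b hb] at hi
      rw [hau] at hi'
      exact absurd (hi.trans hi'.symm) (hj b (Finset.mem_sdiff.1 hb).1)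
    · rw [hao b hb] at hi
      rw [hao b' hb'] at hi'
      exact h.inj b (Finset.mem_sdiff.1 hb).1 b' (Finset.mem_sdiff.1 hb').1 i hi hi'
  · intro b hb i hi S hS
    obtain ⟨S', hS', hU, hle⟩ := hexp S hS
    rw [← hU]
    rcases Finset.mem_insert.1 hb with hbu | hb
    · subst hbu
      rw [hau] at hi
      obtain rfl : j = i := by simpa using hi
      have := hDmax' S' hS'
      rw [hqu]
      rw [← hu] at this
      linarith
    · rw [hao b hb] at hi
      have := h.dem b (Finset.mem_sdiff.1 hb).1 i hi S' hS'
      rw [hqo b hb]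
      linarith
  · rw [htot]
    linarith [h.total]

/-- Approximate equilibria exist for every positive `e`. -/
theorem approx_eq {n m : ℕ} (hn : 1 ≤ n) (Mk : Market n m)
    (B : Finset (Finset (Fin m))) (p : Finset (Fin m) → ℝ)
    (hB1 : ∀ b ∈ B, b.Nonempty)
    (hB2 : ∀ b ∈ B, ∀ b' ∈ B, b ≠ b' → Disjoint b b')
    (hB3 : B.biUnion id = Finset.univ)
    (hp : ∀ b ∈ B, 0 ≤ p b)
    (hdem : ∀ b ∈ B,
      B.card ≤ (Finset.univ.filter fun i : Fin n => 0 < Mk.v i b - p b).card)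
    (e : ℝ) (he : 0 < e) :
    ∃ (C : Finset (Finset (Fin m))) (s : Finset (Fin m) → Fin n) (q : Finset (Fin m) → ℝ),
      (∀ b ∈ C, b.Nonempty) ∧ (∀ b ∈ C, ∀ b' ∈ C, b ≠ b' → Disjoint b b') ∧
      C.biUnion id = Finset.univ ∧
      (∀ b, 0 ≤ q b) ∧ (∀ b, q b ≤ ∑ i, Mk.v i Finset.univ + e) ∧
      (∑ b ∈ B, p b ≤ ∑ b ∈ C, q b) ∧
      ∀ i : Fin n, ∀ T : Finset (Finset (Fin m)), T ⊆ C →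
        Mk.v i (T.biUnion id) - ∑ b ∈ T, q b ≤
        Mk.v i ((C.filter fun b => s b = i).biUnion id)
        - ∑ b ∈ C.filter fun b => s b = i, q b + e := by
  classical
  have hv0 : ∀ i S, 0 ≤ Mk.v i S := fun i S => by
    rw [← Mk.v_empty i]; exact Mk.v_mono i _ _ (Finset.empty_subset _)
  have hvle : ∀ i S, Mk.v i S ≤ ∑ i, Mk.v i Finset.univ := fun i S =>
    (Mk.v_mono i _ _ (Finset.subset_univ S)).trans
      (Finset.single_le_sum (f := fun i => Mk.v i Finset.univ)
        (fun k _ => hv0 k _) (Finset.mem_univ i))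
  have hV : 0 ≤ ∑ i, Mk.v i Finset.univ := Finset.sum_nonneg fun i _ => hv0 i _
  have hP : 0 ≤ ∑ b ∈ B, p b := Finset.sum_nonneg hp
  have hbd : ∀ C q a, GoodState Mk B p e C q a → ∀ b ∈ C, ∀ i, a b = some i →
      q b ≤ ∑ i, Mk.v i Finset.univ + e := by
    intro C q a h b hb i hi
    have h1 := h.dem b hb i hi ∅ (Finset.empty_subset _)
    simp only [Finset.biUnion_empty, Finset.sum_empty, Mk.v_empty] at h1
    linarith [hvle i b]
  let X : Set ℝ := {t | ∃ C q a, GoodState Mk B p e C q a ∧ ∑ b ∈ C, q b = t}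
  have hXne : X.Nonempty := ⟨_, B, p, fun _ => none,
    ⟨hB1, hB2, hB3, hp, le_rfl, fun b hb _ => ⟨hb, rfl⟩, by simp, by simp, le_rfl⟩, rfl⟩
  have hXb : BddAbove X := by
    refine ⟨B.card * (∑ i, Mk.v i Finset.univ + e + ∑ b ∈ B, p b), ?_⟩
    rintro t ⟨C, q, a, h, rfl⟩
    have h1 : ∑ b ∈ C, q b ≤ C.card • (∑ i, Mk.v i Finset.univ + e + ∑ b ∈ B, p b) := by
      apply Finset.sum_le_card_nsmul
      intro b hb
      cases hab : a b with
      | none =>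
        obtain ⟨h1, h2⟩ := h.unalloc b hb hab
        rw [h2]
        linarith [Finset.single_le_sum hp h1]
      | some i => linarith [hbd C q a h b hb i hab]
    rw [nsmul_eq_mul] at h1
    refine h1.trans (mul_le_mul_of_nonneg_right (by exact_mod_cast h.card) (by linarith))
  obtain ⟨t, ⟨C, q, a, h, rfl⟩, ht⟩ := exists_lt_of_lt_csSup hXne (show sSup X - e < sSup X by linarith)
  have hfin : ∀ j, (∀ b ∈ C, a b ≠ some j) → ∀ T, T ⊆ C →
      Mk.v j (T.biUnion id) - ∑ x ∈ T, q x ≤ 0 := by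
    intro j hj T hT
    by_contra! hc
    obtain ⟨C', q', a', h', hs⟩ := h.step he j hj T hT hc
    have := le_csSup hXb (show ∑ b ∈ C', q' b ∈ X from ⟨C', q', a', h', rfl⟩)
    linarith
  have hall : ∀ b ∈ C, a b ≠ none := by
    intro b hb hab
    obtain ⟨h1, h2⟩ := h.unalloc b hb hab
    have hsub : (Finset.univ.filter fun i : Fin n => 0 < Mk.v i b - p b).image some ⊆
        (C.erase b).image a := by
      intro o ho
      obtain ⟨i, hi, rfl⟩ := Finset.mem_image.1 ho
      rw [Finset.mem_filter] at hi
      by_contra hc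
      have := hfin i (fun b' hb' hbi => hc (Finset.mem_image.2 ⟨b', Finset.mem_erase.2
        ⟨by rintro rfl; simp [hab] at hbi, hb'⟩, hbi⟩)) {b} (by simpa using hb)
      simp only [Finset.singleton_biUnion, Finset.sum_singleton, id, h2] at this
      linarith [hi.2]
    have c1 := Finset.card_le_card hsub
    rw [Finset.card_image_of_injective _ (Option.some_injective _)] at c1
    have c2 := Finset.card_image_le (s := C.erase b) (f := a)
    have c3 := Finset.card_erase_lt_of_mem hb
    have c4 := hdem b h1
    have c5 := h.card
    omega
  let s : Finset (Fin m) → Fin n := fun b => (a b).getD ⟨0, hn⟩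
  have hs : ∀ b ∈ C, a b = some (s b) := by
    intro b hb
    cases hab : a b with
    | none => exact absurd hab (hall b hb)
    | some i => simp [s, hab]
  have hsumq : ∀ T, T ⊆ C → ∑ b ∈ T, (if b ∈ C then q b else 0) = ∑ b ∈ T, q b :=
    fun T hT => Finset.sum_congr rfl fun b hb => if_pos (hT hb)
  refine ⟨C, s, fun b => if b ∈ C then q b else 0, h.ne, h.disj, h.cover, ?_, ?_, ?_, ?_⟩
  · intro b
    dsimp only
    split_ifs with hb
    · exact h.nonneg b hb
    · exact le_rfl
  · intro b
    dsimp only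
    split_ifs with hb
    · exact hbd C q a h b hb _ (hs b hb)
    · linarith
  · rw [hsumq C subset_rfl]
    exact h.total
  · intro i T hT
    rw [hsumq T hT, hsumq _ (Finset.filter_subset _ _)]
    by_cases hi : ∃ b ∈ C, a b = some i
    · obtain ⟨b, hb, hbi⟩ := hi
      have hf : (C.filter fun b => s b = i) = {b} := by
        ext b'
        simp only [Finset.mem_filter, Finset.mem_singleton]
        constructor
        · rintro ⟨h1, h2⟩
          exact h.inj b' h1 b hb i (h2 ▸ hs b' h1) hbi
        · rintro rfl
          exact ⟨hb, by simp [s, hbi]⟩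
      rw [hf]
      simpa using h.dem b hb i hbi T hT
    · push Not at hi
      have hf : (C.filter fun b => s b = i) = ∅ := by
        rw [Finset.filter_eq_empty_iff]
        intro b hb hh
        exact hi b hb (hh ▸ hs b hb)
      rw [hf]
      have := hfin i hi T hT
      simp only [Finset.biUnion_empty, Finset.sum_empty, Mk.v_empty]
      linarith

/-- A high-demand priced bundling (every bundle is strictly profitable
for at least `|𝓑|` consumers) yields a CBE whose welfare is at least the aggregate
price of the bundling. -/
theorem cbe_from_high_demand (n m : ℕ) (hn : 1 ≤ n) (hm : 1 ≤ m) (Mk : Market n m)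
    (B : Finset (Finset (Fin m))) (p : Finset (Fin m) → ℝ)
    (hB1 : ∀ b ∈ B, b.Nonempty)
    (hB2 : ∀ b ∈ B, ∀ b' ∈ B, b ≠ b' → Disjoint b b')
    (hB3 : B.biUnion id = Finset.univ)
    (hp : ∀ b ∈ B, 0 ≤ p b)
    (hdem : ∀ b ∈ B,
      B.card ≤ (Finset.univ.filter fun i : Fin n => 0 < Mk.v i b - p b).card) :
    ∃ E : CBE Mk, E.welfare ≥ ∑ b ∈ B, p b := by
  classical
  choose C s q h1 h2 h3 h4 h5 h6 h7 using fun k : ℕ =>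
    approx_eq hn Mk B p hB1 hB2 hB3 hp hdem (1 / ((k : ℝ) + 1)) (by positivity)
  have hcpt : IsCompact (Set.Icc (fun _ : Finset (Fin m) => (0 : ℝ))
      (fun _ => ∑ i, Mk.v i Finset.univ + 1)) := isCompact_Icc
  obtain ⟨r, -, φ, hφ, hr⟩ := hcpt.tendsto_subseq (x := q) (fun k => by
    refine ⟨fun b => h4 k b, fun b => (h5 k b).trans ?_⟩
    have : 1 / ((k : ℝ) + 1) ≤ 1 := by
      rw [div_le_one (by positivity)]
      linarith [(Nat.cast_nonneg k : (0 : ℝ) ≤ k)]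
    linarith)
  have hrb : ∀ b, Filter.Tendsto (fun k => q (φ k) b) Filter.atTop (nhds (r b)) :=
    fun b => (tendsto_pi_nhds.1 hr) b
  have hrs : ∀ T : Finset (Finset (Fin m)),
      Filter.Tendsto (fun k => ∑ b ∈ T, q (φ k) b) Filter.atTop (nhds (∑ b ∈ T, r b)) :=
    fun T => tendsto_finsetSum _ fun b _ => hrb b
  have hre : Filter.Tendsto (fun k => 1 / ((φ k : ℝ) + 1)) Filter.atTop (nhds 0) :=
    tendsto_one_div_add_atTop_nhds_zero_nat.comp hφ.tendsto_atTop
  obtain ⟨c, hc⟩ : ∃ c : Finset (Finset (Fin m)) × (Finset (Fin m) → Fin n),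
      ∃ᶠ k in Filter.atTop, (C (φ k), s (φ k)) = c := by
    by_contra! hcon
    obtain ⟨k, hk⟩ := (Filter.eventually_all.2 hcon).exists
    exact hk _ rfl
  obtain ⟨D, σ⟩ := c
  have hc' : ∃ᶠ k in Filter.atTop, C (φ k) = D ∧ s (φ k) = σ := by
    simpa only [Prod.mk.injEq] using hc
  obtain ⟨k0, hk0, hk0'⟩ := hc'.exists
  have hmax : ∀ i : Fin n, ∀ T : Finset (Finset (Fin m)), T ⊆ D →
      Mk.v i (T.biUnion id) - ∑ b ∈ T, r b ≤
      Mk.v i ((D.filter fun b => σ b = i).biUnion id)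
        - ∑ b ∈ D.filter fun b => σ b = i, r b := by
    intro i T hT
    have ht := ((hrs (D.filter fun b => σ b = i)).const_sub
      (Mk.v i ((D.filter fun b => σ b = i).biUnion id))).add hre
    have ht' := ht.sub ((hrs T).const_sub (Mk.v i (T.biUnion id)))
    have := isClosed_Ici.mem_of_frequently_of_tendsto (s := Set.Ici (0 : ℝ)) (hc'.mono ?_) ht'
    · have := Set.mem_Ici.1 this
      linarith
    · rintro k ⟨rfl, rfl⟩
      have := h7 (φ k) i T hT
      rw [Set.mem_Ici]
      linarith
  have htot : ∑ b ∈ B, p b ≤ ∑ b ∈ D, r b := by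
    refine isClosed_Ici.mem_of_frequently_of_tendsto (s := Set.Ici (∑ b ∈ B, p b))
      (hc'.mono ?_) (hrs D)
    rintro k ⟨rfl, rfl⟩
    exact h6 (φ k)
  refine ⟨⟨D, r, σ, hk0 ▸ h1 (φ k0), hk0 ▸ h2 (φ k0), hk0 ▸ h3 (φ k0), fun b _ =>
    ge_of_tendsto' (hrb b) fun k => h4 _ b, fun i T hT => hmax i T hT⟩, ?_⟩
  refine htot.trans ?_
  rw [CBE.welfare, ← Finset.sum_fiberwise D σ r]
  refine Finset.sum_le_sum fun i _ => ?_
  have := hmax i ∅ (Finset.empty_subset _)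
  simp only [Finset.biUnion_empty, Finset.sum_empty, Mk.v_empty] at this
  linarith
end
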